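/- arXiv:1308.2183 — 11 statements merged into one kernel-verified Lean document; each statement's English description precedes it below -/
import Mathlib

section
/- Let G be a finite simple graph with vertex set V and let x be a vertex of G of positive degree. Then for all functions f, g : V → ℝ, one has ∑_{y∈V} |(A_x f)(y) − (A_x g)(y)| ≤ ∑_{y∈V} |f(y) − g(y)|; that is, every meteor redistribution map A_x is nonexpansive with respect to the ℓ¹ norm. -/
open scoped Classical

/-- The meteor redistribution map `A_x` of a simple graph `G`: the mass at `x` is set to `0`
and distributed equally among the neighbors of `x`. -/
noncomputable def meteorMap {V : Type*} (G : SimpleGraph V) (x : V) (f : V → ℝ) : V → ℝ :=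
  fun y =>
    if y = x then 0
    else if G.Adj x y then f y + f x / ((G.neighborSet x).ncard : ℝ)
    else f y

/-- The contribution of a single vertex to the `ℓ¹` distance after redistribution. -/
lemma abs_meteorMap_sub_le {V : Type*} (G : SimpleGraph V) (x : V) (f g : V → ℝ) (y : V) :
    |meteorMap G x f y - meteorMap G x g y| ≤
      |f y - g y| - (if y = x then |f x - g x| else 0) +
        (if G.Adj x y then |f x - g x| / ((G.neighborSet x).ncard : ℝ) else 0) := by
  unfold meteorMap
  by_cases hy : y = x
  · subst hy
    simp
  · by_cases hadj : G.Adj x y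
    · simp only [hy, hadj, if_true, if_false, sub_zero]
      have hd : (0 : ℝ) ≤ ((G.neighborSet x).ncard : ℝ) := Nat.cast_nonneg _
      calc _ = |(f y - g y) + (f x - g x) / ((G.neighborSet x).ncard : ℝ)| := by
            congr 1
            ring
        _ ≤ |f y - g y| + |(f x - g x) / ((G.neighborSet x).ncard : ℝ)| := abs_add_le _ _
        _ = _ := by rw [abs_div, abs_of_nonneg hd]
    · simp [hy, hadj]

/-- Equal shares of `c` handed to the neighbors of `x` add up to `c`. -/
lemma sum_adj_div_ncard_neighborSet {V : Type*} [Fintype V] (G : SimpleGraph V) (x : V)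
    (hx : 0 < (G.neighborSet x).ncard) (c : ℝ) :
    ∑ y : V, (if G.Adj x y then c / ((G.neighborSet x).ncard : ℝ) else 0) = c := by
  have hcard : (Finset.univ.filter fun y => G.Adj x y).card = (G.neighborSet x).ncard := by
    rw [← Set.ncard_coe_finset]
    congr 1
    ext y
    simp
  rw [← Finset.sum_filter, Finset.sum_const, hcard, nsmul_eq_mul]
  field_simp

/-- for a vertex `x` of positive degree, the meteor redistribution map `A_x`
is nonexpansive with respect to the `ℓ¹` norm. -/
theorem meteorMap_l1_nonexpansive {V : Type*} [Fintype V] (G : SimpleGraph V) (x : V)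
    (hx : 0 < (G.neighborSet x).ncard) (f g : V → ℝ) :
    ∑ y : V, |meteorMap G x f y - meteorMap G x g y| ≤ ∑ y : V, |f y - g y| := by
  calc _ ≤ ∑ y : V, (|f y - g y| - (if y = x then |f x - g x| else 0) +
        (if G.Adj x y then |f x - g x| / ((G.neighborSet x).ncard : ℝ) else 0)) :=
        Finset.sum_le_sum fun y _ => abs_meteorMap_sub_le G x f g y
    _ = _ := by
      rw [Finset.sum_add_distrib, Finset.sum_sub_distrib, sum_adj_div_ncard_neighborSet G x hx]
      simp
end

section
/- Let G be a finite connected simple graph with vertex set V, |V| = k ≥ 2, and maximal vertex degree d. Let y ∈ V and let x_1, x_2, …, x_n be a sequence of vertices (not necessarily distinct) such that x_j is adjacent to x_{j+1} for 1 ≤ j ≤ n−1, x_n is adjacent to y, and {x_1, …, x_n} = V \ {y}. Then for every nonnegative function f : V → [0,∞), writing g = A_{x_n} ∘ ⋯ ∘ A_{x_2} ∘ A_{x_1} f, one has ∑_{v ≠ y} g(v) ≤ (1 − d^{−n}/(k−1)) · ∑_{v ≠ y} f(v). -/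
open scoped Classical

theorem meteorMap_eq {V : Type*} (G : SimpleGraph V) (a : V) (f : V → ℝ) (v : V) :
    meteorMap G a f v = f v + (if G.Adj a v then f a / ((G.neighborSet a).ncard : ℝ) else 0)
      - (if v = a then f a else 0) := by
  unfold meteorMap
  by_cases hv : v = a
  · subst hv; simp
  · by_cases h : G.Adj a v <;> simp [hv, h]

/-- A meteor hitting a non-isolated vertex preserves the total mass. -/
theorem sum_meteorMap {V : Type*} [Fintype V] (G : SimpleGraph V) {a b : V} (hab : G.Adj a b)
    (f : V → ℝ) : ∑ v, meteorMap G a f v = ∑ v, f v := by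
  have hpos : 0 < (G.neighborSet a).ncard := (Set.ncard_pos (Set.toFinite _)).2 ⟨b, hab⟩
  have hcard : (G.neighborSet a).ncard = (Finset.univ.filter fun v => G.Adj a v).card := by
    rw [← Set.ncard_coe_finset]
    congr 1
    ext v
    simp
  simp_rw [meteorMap_eq, Finset.sum_sub_distrib, Finset.sum_add_distrib]
  rw [← Finset.sum_filter, Finset.sum_const, ← hcard, nsmul_eq_mul, Finset.sum_ite_eq' _ a,
    if_pos (Finset.mem_univ a), mul_div_cancel₀ _ (by positivity)]
  ring

theorem meteorMap_nonneg {V : Type*} (G : SimpleGraph V) (a : V) {f : V → ℝ}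
    (hf : ∀ v, 0 ≤ f v) (v : V) : 0 ≤ meteorMap G a f v := by
  have := hf a
  have := hf v
  unfold meteorMap
  split_ifs <;> positivity

theorem le_meteorMap_of_ne {V : Type*} (G : SimpleGraph V) {a v : V} {f : V → ℝ}
    (ha : 0 ≤ f a) (hv : v ≠ a) : f v ≤ meteorMap G a f v := by
  rw [meteorMap_eq, if_neg hv, sub_zero]
  split_ifs
  · exact le_add_of_nonneg_right (by positivity)
  · simp

/-- A neighbor of the vertex hit receives at least a `1/d` share of the mass there. -/
theorem add_div_le_meteorMap {V : Type*} [Finite V] (G : SimpleGraph V) {d : ℕ}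
    (hd : ∀ v : V, (G.neighborSet v).ncard ≤ d) {a b : V} (hab : G.Adj a b) {f : V → ℝ}
    (ha : 0 ≤ f a) : f b + f a / d ≤ meteorMap G a f b := by
  have hpos : 0 < (G.neighborSet a).ncard := (Set.ncard_pos (Set.toFinite _)).2 ⟨b, hab⟩
  rw [meteorMap_eq, if_pos hab, if_neg hab.ne', sub_zero]
  have := hd a
  gcongr

/-- Meteors along a walk preserve the total mass. -/
theorem sum_foldl_meteorMap {V : Type*} [Fintype V] (G : SimpleGraph V) (y : V) :
    ∀ (l : List V) (f : V → ℝ), List.IsChain G.Adj (l ++ [y]) →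
      ∑ v, l.foldl (fun h v => meteorMap G v h) f v = ∑ v, f v
  | [], _, _ => rfl
  | [a], f, h => sum_meteorMap G (by simpa using h : G.Adj a y) f
  | a :: b :: l, f, h => by
    simp only [List.cons_append, List.isChain_cons_cons] at h
    rw [List.foldl_cons, sum_foldl_meteorMap G y (b :: l) _ (by simpa using h.2),
      sum_meteorMap G h.1]

/-- When meteors hit along a walk towards `y`, at least a `d ^ (-n)` share of the mass at any
vertex of the walk reaches `y`, where `n` is the length of the walk. -/
theorem add_div_pow_le_foldl_meteorMap {V : Type*} [Finite V] (G : SimpleGraph V) {d : ℕ}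
    (hd : ∀ v : V, (G.neighborSet v).ncard ≤ d) (y : V) :
    ∀ (l : List V) (f : V → ℝ), List.IsChain G.Adj (l ++ [y]) → y ∉ l → (∀ v, 0 ≤ f v) →
      ∀ v ∈ l, f y + f v / (d : ℝ) ^ l.length ≤ l.foldl (fun h v => meteorMap G v h) f y
  | [], _, _, _, _, _, hv => by simp at hv
  | [a], f, h, _, hf, v, hv => by
    obtain rfl : v = a := by simpa using hv
    simpa using add_div_le_meteorMap G hd (by simpa using h : G.Adj v y) (hf v)
  | a :: b :: l, f, h, hy, hf, v, hv => by
    simp only [List.cons_append, List.isChain_cons_cons] at h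
    have hya : y ≠ a := fun e => hy (by simp [e])
    have hd1 : (1 : ℝ) ≤ d := by
      exact_mod_cast ((Set.ncard_pos (Set.toFinite _)).2 ⟨b, h.1⟩ :
        0 < (G.neighborSet a).ncard).trans_le (hd a)
    have ih := add_div_pow_le_foldl_meteorMap G hd y (b :: l) (meteorMap G a f)
      (by simpa using h.2) (fun e => hy (List.mem_cons_of_mem _ e)) (meteorMap_nonneg G a hf)
    have hfy := le_meteorMap_of_ne G (hf a) hya
    rw [List.foldl_cons, List.length_cons, pow_succ']
    by_cases hva : v = a
    · subst hva
      refine le_trans ?_ (ih b (by simp))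
      rw [← div_div]
      gcongr
      exact (le_add_of_nonneg_left (hf b)).trans (add_div_le_meteorMap G hd h.1 (hf v))
    · refine le_trans ?_ (ih v ((List.mem_cons.1 hv).resolve_left hva))
      have hfv := le_meteorMap_of_ne G (hf a) hva
      have := hf v
      have := meteorMap_nonneg G a hf v
      gcongr
      exact le_mul_of_one_le_left (by positivity) hd1

/-- Let `G` be a finite connected simple graph with `k = |V| ≥ 2` vertices and
maximal degree `d`.  If `x₁, …, xₙ` is a walk-like sequence of vertices with `xⱼ ~ xⱼ₊₁`,
`xₙ ~ y` and `{x₁,…,xₙ} = V \ {y}`, then applying the meteor maps `A_{x₁}, …, A_{xₙ}` in this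
order to a nonnegative `f` reduces the total mass outside `y` at least by the factor
`1 − d^{−n}/(k−1)`. -/
theorem mass_outside_reduction {V : Type*} [Fintype V] (G : SimpleGraph V)
    (hconn : G.Connected) (hk : 2 ≤ Fintype.card V)
    (d : ℕ) (hd_mem : ∃ v : V, (G.neighborSet v).ncard = d)
    (hd_max : ∀ v : V, (G.neighborSet v).ncard ≤ d)
    (y : V) (n : ℕ) (hn : 0 < n) (x : Fin n → V)
    (hadj : ∀ (i : Fin n) (h : i.val + 1 < n), G.Adj (x i) (x ⟨i.val + 1, h⟩))
    (hlast : G.Adj (x ⟨n - 1, by omega⟩) y)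
    (hrange : Set.range x = {v : V | v ≠ y})
    (f : V → ℝ) (hf : ∀ v, 0 ≤ f v) :
    ∑ v ∈ Finset.univ.erase y, (List.ofFn x).foldl (fun h v => meteorMap G v h) f v
      ≤ (1 - ((d : ℝ) ^ n)⁻¹ / ((Fintype.card V : ℝ) - 1)) *
          ∑ v ∈ Finset.univ.erase y, f v := by
  set l := List.ofFn x with hl
  have hmem : ∀ v, v ∈ l ↔ v ≠ y := fun v => by
    rw [hl, List.mem_ofFn, ← Set.mem_range, hrange, Set.mem_ofPred_eq]
  have hchain : List.IsChain G.Adj (l ++ [y]) := by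
    rw [List.isChain_iff_getElem]
    intro i hi
    simp only [hl, List.length_append, List.length_ofFn, List.length_singleton] at hi
    by_cases h : i + 1 < n
    · simpa [hl, List.getElem_append, h, Nat.lt_of_succ_lt h] using hadj ⟨i, by omega⟩ h
    · obtain rfl : i = n - 1 := by omega
      simpa [hl, List.getElem_append, hn, h] using hlast
  have hsum := sum_foldl_meteorMap G y l f hchain
  have hcard : ((Finset.univ.erase y).card : ℝ) = (Fintype.card V : ℝ) - 1 := by
    rw [Finset.card_erase_of_mem (Finset.mem_univ y), Finset.card_univ, Nat.cast_sub (by omega),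
      Nat.cast_one]
  have hkpos : (0 : ℝ) < (Fintype.card V : ℝ) - 1 := by
    have : (2 : ℝ) ≤ Fintype.card V := by exact_mod_cast hk
    linarith
  obtain ⟨v, hv, hvle⟩ : ∃ v ∈ Finset.univ.erase y,
      (∑ w ∈ Finset.univ.erase y, f w) / ((Fintype.card V : ℝ) - 1) ≤ f v := by
    refine Finset.exists_le_of_sum_le ⟨_, Finset.mem_erase.2 ⟨hlast.ne, Finset.mem_univ _⟩⟩ ?_
    rw [Finset.sum_const, nsmul_eq_mul, hcard, mul_div_cancel₀ _ hkpos.ne']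
  have hgain := add_div_pow_le_foldl_meteorMap G hd_max y l f hchain
    (fun h => (hmem y).1 h rfl) hf v ((hmem v).2 (Finset.ne_of_mem_erase hv))
  rw [hl, List.length_ofFn, ← hl] at hgain
  rw [← Finset.add_sum_erase _ _ (Finset.mem_univ y), ← Finset.add_sum_erase _ f
    (Finset.mem_univ y)] at hsum
  have hshare := mul_le_mul_of_nonneg_left hvle (by positivity : 0 ≤ ((d : ℝ) ^ n)⁻¹)
  rw [div_eq_inv_mul] at hgain
  calc _ ≤ (∑ w ∈ Finset.univ.erase y, f w) - ((d : ℝ) ^ n)⁻¹ *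
        ((∑ w ∈ Finset.univ.erase y, f w) / ((Fintype.card V : ℝ) - 1)) := by linarith
    _ = _ := by ring
end

section
/- For every integer n ≥ 1, the number of permutations σ of {1, 2, …, n+4} whose peak set is exactly {2, n+3} equals n(n+3)·2^{n+1}. Equivalently, the probability that a uniformly random permutation of {1,…,n+4} has peak set exactly {2, n+3} is n(n+3)·2^{n+1}/(n+4)!. -/
open scoped Classical

/-- The value of the permutation `σ` of `{1,…,m}` at the (1-based) position `i`,
with junk value `0` outside `{1,…,m}`.  Values are the 0-based `Fin m` values,
which have the same relative order as the 1-based values. -/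
def permVal {m : ℕ} (σ : Equiv.Perm (Fin m)) (i : ℕ) : ℕ :=
  if h : 1 ≤ i ∧ i ≤ m then (σ ⟨i - 1, by omega⟩ : ℕ) else 0

/-- The peak set of a permutation `σ` of `{1,…,m}` (1-based positions):
`j` with `2 ≤ j ≤ m-1` is a peak iff `σ(j-1) < σ(j) > σ(j+1)`. -/
def peakSet {m : ℕ} (σ : Equiv.Perm (Fin m)) : Finset ℕ :=
  (Finset.Ioo 1 m).filter fun j =>
    permVal σ (j - 1) < permVal σ j ∧ permVal σ (j + 1) < permVal σ j

/-- `f` has no triple of positions `i < j < k` with `f i < f j > f k`. -/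
def Unpeaked {k l : ℕ} (f : Fin k → Fin l) : Prop :=
  ∀ x y z : Fin k, x < y → y < z → ¬(f x < f y ∧ f z < f y)

/-- The permutation sending `i` to `a` whose other values are in the same relative order as
those of `τ`. -/
def permInsert {m : ℕ} (i a : Fin (m + 1)) (τ : Equiv.Perm (Fin m)) :
    Equiv.Perm (Fin (m + 1)) :=
  (finSuccEquiv' i).trans ((Equiv.optionCongr τ).trans (finSuccEquiv' a).symm)

@[simp] lemma permInsert_self {m : ℕ} (i a : Fin (m + 1)) (τ : Equiv.Perm (Fin m)) :
    permInsert i a τ i = a := by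
  simp [permInsert]

@[simp] lemma permInsert_succAbove {m : ℕ} (i a : Fin (m + 1)) (τ : Equiv.Perm (Fin m))
    (j : Fin m) : permInsert i a τ (i.succAbove j) = a.succAbove (τ j) := by
  simp [permInsert]

lemma permInsert_right_cancel {m : ℕ} {i a : Fin (m + 1)} {τ τ' : Equiv.Perm (Fin m)}
    (h : permInsert i a τ = permInsert i a τ') : τ = τ' := by
  ext j
  have hj := DFunLike.congr_fun h (i.succAbove j)
  rw [permInsert_succAbove, permInsert_succAbove, Fin.succAbove_right_inj] at hj
  rw [hj]

lemma permInsert_bijective_left {m : ℕ} (i : Fin (m + 1)) :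
    Function.Bijective fun p : Fin (m + 1) × Equiv.Perm (Fin m) => permInsert i p.1 p.2 := by
  rw [Fintype.bijective_iff_injective_and_card]
  refine ⟨?_, by simp [Fintype.card_perm, Nat.factorial_succ]⟩
  rintro ⟨a, τ⟩ ⟨b, τ'⟩ h
  have hab : a = b := by simpa using congrArg (fun σ => σ i) h
  subst hab
  exact congrArg _ (permInsert_right_cancel h)

lemma permInsert_bijective_right {m : ℕ} (a : Fin (m + 1)) :
    Function.Bijective fun p : Fin (m + 1) × Equiv.Perm (Fin m) => permInsert p.1 a p.2 := by
  rw [Fintype.bijective_iff_injective_and_card]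
  refine ⟨?_, by simp [Fintype.card_perm, Nat.factorial_succ]⟩
  rintro ⟨i, τ⟩ ⟨j, τ'⟩ h
  have hij : i = j := by
    apply (permInsert j a τ').injective
    exact (DFunLike.congr_fun h.symm i).trans
      ((permInsert_self i a τ).trans (permInsert_self j a τ').symm)
  subst hij
  exact congrArg _ (permInsert_right_cancel h)

lemma card_filter_of_permInsert {m : ℕ} (i : Fin (m + 1)) (P : Equiv.Perm (Fin (m + 1)) → Prop)
    (Q : Equiv.Perm (Fin m) → Prop) (h : ∀ a τ, P (permInsert i a τ) ↔ Q τ) :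
    (Finset.univ.filter P).card = (m + 1) * (Finset.univ.filter Q).card := by
  have : (Finset.univ ×ˢ Finset.univ.filter Q).card = (Finset.univ.filter P).card :=
    Finset.card_bijective _ (permInsert_bijective_left i) (by simp [h])
  rw [← this, Finset.card_product]
  simp

lemma unpeaked_comp_iff {k l l' : ℕ} {g : Fin l → Fin l'} (hg : StrictMono g)
    (f : Fin k → Fin l) : Unpeaked (g ∘ f) ↔ Unpeaked f := by
  simp [Unpeaked, hg.lt_iff_lt]

lemma unpeaked_permInsert_last_iff {m : ℕ} (i : Fin (m + 1)) (τ : Equiv.Perm (Fin m)) :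
    Unpeaked (permInsert i (Fin.last m) τ) ↔ (i = 0 ∨ i = Fin.last m) ∧ Unpeaked τ := by
  have hlt : ∀ j, j ≠ i → permInsert i (Fin.last m) τ j < permInsert i (Fin.last m) τ i := by
    intro j hj
    rw [permInsert_self]
    refine Fin.lt_last_iff_ne_last.2 fun h => hj ?_
    exact (permInsert i (Fin.last m) τ).injective (h.trans (permInsert_self i _ τ).symm)
  constructor
  · intro h
    refine ⟨?_, ?_⟩
    · by_contra! hi
      exact h 0 i (Fin.last m) (Fin.pos_iff_ne_zero.2 hi.1) (Fin.lt_last_iff_ne_last.2 hi.2)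
        ⟨hlt _ (Ne.symm hi.1), hlt _ (Ne.symm hi.2)⟩
    · intro x y z hxy hyz
      have := h (i.succAbove x) (i.succAbove y) (i.succAbove z)
        (Fin.strictMono_succAbove i hxy) (Fin.strictMono_succAbove i hyz)
      simpa [(Fin.strictMono_succAbove _).lt_iff_lt] using this
  · rintro ⟨hi, h⟩ x y z hxy hyz ⟨h1, h2⟩
    have hyi : y ≠ i := by
      rintro rfl
      rcases hi with rfl | rfl
      · exact absurd hxy (Fin.not_lt_zero x)
      · exact absurd hyz (Fin.le_last z).not_gt
    have hxi : x ≠ i := by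
      rintro rfl
      exact lt_asymm h1 (hlt y hyi)
    have hzi : z ≠ i := by
      rintro rfl
      exact lt_asymm h2 (hlt y hyi)
    obtain ⟨x, rfl⟩ := Fin.exists_succAbove_eq hxi
    obtain ⟨y, rfl⟩ := Fin.exists_succAbove_eq hyi
    obtain ⟨z, rfl⟩ := Fin.exists_succAbove_eq hzi
    simp only [permInsert_succAbove, (Fin.strictMono_succAbove _).lt_iff_lt] at h1 h2 hxy hyz
    exact h x y z hxy hyz ⟨h1, h2⟩

lemma card_unpeaked_perm (m : ℕ) :
    (Finset.univ.filter fun σ : Equiv.Perm (Fin (m + 1)) => Unpeaked σ).card = 2 ^ m := by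
  induction m with
  | zero =>
    rw [Finset.filter_true_of_mem]
    · simp
    · intro σ _ x y z hxy
      exact absurd hxy (by omega)
  | succ m ih =>
    have : (({0, Fin.last (m + 1)} : Finset (Fin (m + 2))) ×ˢ Finset.univ.filter
        fun τ : Equiv.Perm (Fin (m + 1)) => Unpeaked τ).card = (Finset.univ.filter
        fun σ : Equiv.Perm (Fin (m + 2)) => Unpeaked σ).card :=
      Finset.card_bijective _ (permInsert_bijective_right (Fin.last (m + 1)))
        (by simp [unpeaked_permInsert_last_iff])
    rw [← this, Finset.card_product, ih, Finset.card_pair (Fin.last_pos).ne, pow_succ']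

lemma card_unpeaked_comp_succ {k m : ℕ} (e : Fin k → Fin m) :
    (Finset.univ.filter fun σ : Equiv.Perm (Fin (m + 1)) => Unpeaked (σ ∘ Fin.succ ∘ e)).card =
      (m + 1) * (Finset.univ.filter fun σ : Equiv.Perm (Fin m) => Unpeaked (σ ∘ e)).card := by
  refine card_filter_of_permInsert 0 _ _ fun a τ => ?_
  rw [← unpeaked_comp_iff (Fin.strictMono_succAbove a)]
  have : permInsert 0 a τ ∘ Fin.succ ∘ e = a.succAbove ∘ τ ∘ e := by
    funext x
    exact permInsert_succAbove 0 a τ (e x)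
  rw [this]

lemma card_unpeaked_comp_castSucc {k m : ℕ} (e : Fin k → Fin m) :
    (Finset.univ.filter fun σ : Equiv.Perm (Fin (m + 1)) =>
        Unpeaked (σ ∘ Fin.castSucc ∘ e)).card =
      (m + 1) * (Finset.univ.filter fun σ : Equiv.Perm (Fin m) => Unpeaked (σ ∘ e)).card := by
  refine card_filter_of_permInsert (Fin.last m) _ _ fun a τ => ?_
  rw [← unpeaked_comp_iff (Fin.strictMono_succAbove a)]
  have : permInsert (Fin.last m) a τ ∘ Fin.castSucc ∘ e = a.succAbove ∘ τ ∘ e := by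
    funext x
    rw [Function.comp_apply, Function.comp_apply, ← Fin.succAbove_last_apply,
      permInsert_succAbove]
    rfl
  rw [this]

lemma permVal_succ {m : ℕ} (σ : Equiv.Perm (Fin m)) (x : Fin m) :
    permVal σ (x + 1) = σ x := by
  simp [permVal]

/-- The window of `σ` at the (1-based) positions `c + 1, …, c + k` is unpeaked iff `σ` has no
peak strictly inside it. -/
lemma unpeaked_window_iff {k m c : ℕ} (σ : Equiv.Perm (Fin m)) (e : Fin k → Fin m)
    (he : ∀ x, (e x : ℕ) = x + c) :
    Unpeaked (σ ∘ e) ↔ ∀ j ∈ peakSet σ, ¬(c + 1 < j ∧ j < c + k) := by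
  have hval : ∀ x : Fin k, permVal σ (x + c + 1) = (σ ∘ e) x := by
    intro x
    rw [← he, permVal_succ, Function.comp_apply]
  constructor
  · rintro h j hj ⟨h1, h2⟩
    obtain ⟨d, rfl⟩ : ∃ d, j = d + 1 + c + 1 := ⟨j - c - 2, by omega⟩
    simp only [peakSet, Finset.mem_filter] at hj
    obtain ⟨-, hl, hr⟩ := hj
    have hx := hval ⟨d, by omega⟩
    have hy := hval ⟨d + 1, by omega⟩
    have hz := hval ⟨d + 2, by omega⟩
    simp only at hx hy hz
    rw [hy, show d + 1 + c + 1 - 1 = d + c + 1 by omega, hx] at hl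
    rw [hy, show d + 1 + c + 1 + 1 = d + 2 + c + 1 by omega, hz] at hr
    exact h _ _ _ (by simp [Fin.lt_def]) (by simp [Fin.lt_def]) ⟨hl, hr⟩
  · rintro h x y z hxy hyz ⟨h1, h2⟩
    have hinj : Function.Injective (σ ∘ e) := σ.injective.comp fun a b hab => by
      have := congrArg Fin.val hab
      rw [he, he] at this
      exact Fin.ext (by omega)
    obtain ⟨w, hw, hmax⟩ := (Finset.Icc x z).exists_max_image (σ ∘ e)
      ⟨y, Finset.mem_Icc.2 ⟨hxy.le, hyz.le⟩⟩
    have hyw := hmax y (Finset.mem_Icc.2 ⟨hxy.le, hyz.le⟩)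
    rw [Finset.mem_Icc] at hw
    have hxw : x < w := lt_of_le_of_ne hw.1 fun hh => by
      subst hh
      exact absurd h1 hyw.not_gt
    have hwz : w < z := lt_of_le_of_ne hw.2 fun hh => by
      subst hh
      exact absurd h2 hyw.not_gt
    have hlt : ∀ v ∈ Finset.Icc x z, v ≠ w → (σ ∘ e) v < (σ ∘ e) w := fun v hv hne =>
      lt_of_le_of_ne (hmax v hv) fun hh => hne (hinj hh)
    rw [Fin.lt_def] at hxw hwz
    have hz := z.isLt
    have hez := (e z).isLt
    rw [he] at hez
    have hl := hlt ⟨w - 1, by omega⟩ (by simp only [Finset.mem_Icc, Fin.le_def]; omega)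
      (by simp only [ne_eq, Fin.ext_iff]; omega)
    have hr := hlt ⟨w + 1, by omega⟩ (by simp only [Finset.mem_Icc, Fin.le_def]; omega)
      (by simp only [ne_eq, Fin.ext_iff]; omega)
    rw [Fin.lt_def, ← hval, ← hval] at hl hr
    refine h (w + c + 1) ?_ ⟨by omega, by omega⟩
    simp only [peakSet, Finset.mem_filter, Finset.mem_Ioo]
    refine ⟨⟨by omega, by omega⟩, ?_, ?_⟩
    · rwa [show (w : ℕ) - 1 + c + 1 = w + c + 1 - 1 by omega] at hl
    · rwa [show (w : ℕ) + 1 + c + 1 = w + c + 1 + 1 by omega] at hr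

lemma mem_Ioo_of_mem_peakSet {m : ℕ} {σ : Equiv.Perm (Fin m)} {j : ℕ} (hj : j ∈ peakSet σ) :
    1 < j ∧ j < m :=
  Finset.mem_Ioo.1 (Finset.mem_filter.1 hj).1

lemma card_peakSet_subset_empty (n : ℕ) :
    (Finset.univ.filter fun σ : Equiv.Perm (Fin (n + 4)) => peakSet σ ⊆ ∅).card =
      2 ^ (n + 3) := by
  rw [← card_unpeaked_perm (n + 3)]
  congr 1
  refine Finset.filter_congr fun σ _ => ?_
  rw [show (σ : Fin (n + 4) → Fin (n + 4)) = σ ∘ id from rfl,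
    unpeaked_window_iff (c := 0) σ id (fun x => rfl)]
  refine forall₂_congr fun j hj => ?_
  have := mem_Ioo_of_mem_peakSet hj
  simp only [Finset.notMem_empty, false_iff, not_not]
  omega

lemma card_peakSet_subset_left (n : ℕ) :
    (Finset.univ.filter fun σ : Equiv.Perm (Fin (n + 4)) => peakSet σ ⊆ {2}).card =
      (n + 4) * 2 ^ (n + 2) := by
  rw [← card_unpeaked_perm (n + 2)]
  refine Eq.trans ?_ (card_unpeaked_comp_succ (m := n + 3) id)
  congr 1
  refine Finset.filter_congr fun σ _ => ?_
  rw [unpeaked_window_iff (c := 1) σ _ (fun x => by simp)]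
  refine forall₂_congr fun j hj => ?_
  have := mem_Ioo_of_mem_peakSet hj
  simp only [Finset.mem_singleton]
  omega

lemma card_peakSet_subset_right (n : ℕ) :
    (Finset.univ.filter fun σ : Equiv.Perm (Fin (n + 4)) => peakSet σ ⊆ {n + 3}).card =
      (n + 4) * 2 ^ (n + 2) := by
  rw [← card_unpeaked_perm (n + 2)]
  refine Eq.trans ?_ (card_unpeaked_comp_castSucc (m := n + 3) id)
  congr 1
  refine Finset.filter_congr fun σ _ => ?_
  rw [unpeaked_window_iff (c := 0) σ _ (fun x => by simp)]
  refine forall₂_congr fun j hj => ?_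
  have := mem_Ioo_of_mem_peakSet hj
  simp only [Finset.mem_singleton]
  omega

lemma card_peakSet_subset_pair (n : ℕ) :
    (Finset.univ.filter fun σ : Equiv.Perm (Fin (n + 4)) => peakSet σ ⊆ {2, n + 3}).card =
      (n + 4) * ((n + 3) * 2 ^ (n + 1)) := by
  rw [← card_unpeaked_perm (n + 1)]
  refine Eq.trans ?_ ((card_unpeaked_comp_succ (m := n + 3) (Fin.castSucc ∘ id)).trans
    (congrArg _ (card_unpeaked_comp_castSucc (m := n + 2) id)))
  congr 1
  refine Finset.filter_congr fun σ _ => ?_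
  rw [unpeaked_window_iff (c := 1) σ _ (fun x => by simp)]
  refine forall₂_congr fun j hj => ?_
  have := mem_Ioo_of_mem_peakSet hj
  simp only [Finset.mem_insert, Finset.mem_singleton]
  omega

/-- For every integer `n ≥ 1`, the number of permutations of `{1,…,n+4}`
whose peak set is exactly `{2, n+3}` equals `n(n+3)·2^(n+1)`. -/
theorem card_perms_with_peak_set_pair (n : ℕ) (hn : 1 ≤ n) :
    (Finset.univ.filter fun σ : Equiv.Perm (Fin (n + 4)) =>
        peakSet σ = {2, n + 3}).card = n * (n + 3) * 2 ^ (n + 1) := by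
  set A := Finset.univ.filter fun σ : Equiv.Perm (Fin (n + 4)) => peakSet σ = {2, n + 3}
  set L := Finset.univ.filter fun σ : Equiv.Perm (Fin (n + 4)) => peakSet σ ⊆ {2} with hL
  set R := Finset.univ.filter fun σ : Equiv.Perm (Fin (n + 4)) => peakSet σ ⊆ {n + 3} with hR
  have hinter : (L ∩ R).card = 2 ^ (n + 3) := by
    rw [← card_peakSet_subset_empty, hL, hR, ← Finset.filter_and]
    congr 1
    refine Finset.filter_congr fun σ _ => ?_
    rw [← Finset.subset_inter_iff, Finset.singleton_inter_of_notMem (by simp)]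
  have hdisj : Disjoint A (L ∪ R) := by
    rw [Finset.disjoint_left]
    intro σ hA hLR
    simp only [A, L, R, Finset.mem_union, Finset.mem_filter_univ] at hA hLR
    rw [hA] at hLR
    simp only [Finset.insert_subset_iff, Finset.singleton_subset_iff,
      Finset.mem_singleton] at hLR
    omega
  have hunion : A ∪ (L ∪ R) =
      Finset.univ.filter fun σ : Equiv.Perm (Fin (n + 4)) => peakSet σ ⊆ {2, n + 3} := by
    ext σ
    simp only [A, L, R, Finset.mem_union, Finset.mem_filter_univ, ← Finset.coe_subset,
      ← Finset.coe_inj, Finset.coe_pair, Finset.coe_singleton, Set.subset_pair_iff_eq,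
      Set.subset_singleton_iff_eq]
    tauto
  have hcard := card_peakSet_subset_pair n
  rw [← hunion, Finset.card_union_of_disjoint hdisj] at hcard
  have hLR := Finset.card_union_add_card_inter L R
  rw [hinter, card_peakSet_subset_left, card_peakSet_subset_right] at hLR
  have hpow : 2 ^ (n + 2) = 2 * 2 ^ (n + 1) ∧ 2 ^ (n + 3) = 4 * 2 ^ (n + 1) :=
    ⟨by ring, by ring⟩
  rw [hpow.1, hpow.2] at hLR
  nlinarith
end

section
/- For all integers i, j ≥ 1, the number of permutations σ of {1, 2, …, i+j+5} whose peak set is exactly {2, i+3, i+j+4} equals 2^{i+j} · [ (i+j+4)·( j·C(i+j+1, i−1) + (j+1)·C(i+j+1, i) + (i+1)·C(i+j+1, i+1) + i·C(i+j+1, i+2) − 2(i+j+1) ) + i·j·C(i+j+4, i+2) ], where C(a,b) denotes the binomial coefficient. Equivalently, the probability that a uniformly random permutation of {1,…,i+j+5} has peak set exactly {2, i+3, i+j+4} is this number divided by (i+j+5)!. -/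
open scoped Classical

namespace PeakCount

/-- The (1-based) peak set of a list of natural numbers. -/
def listPeaks (l : List ℕ) : Finset ℕ :=
  (Finset.Ioo 1 l.length).filter fun j =>
    l.getD (j - 2) 0 < l.getD (j - 1) 0 ∧ l.getD j 0 < l.getD (j - 1) 0

/-- The lists containing each element of `U` exactly once. -/
noncomputable def arrangements (U : Finset ℕ) : Finset (List ℕ) :=
  U.val.lists.toFinset

/-- The number of arrangements of the elements of `U` in a list with peak set `S`. -/
noncomputable def arrangementCount (S U : Finset ℕ) : ℕ :=
  ((arrangements U).filter fun l => listPeaks l = S).card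

/-- The number of arrangements of `{0,…,n-1}` with peak set `S`. -/
noncomputable def peakCount (S : Finset ℕ) (n : ℕ) : ℕ :=
  arrangementCount S (Finset.range n)

/-- The part of `S` lying to the left of position `k + 1`. -/
def below (k : ℕ) (S : Finset ℕ) : Finset ℕ := S.filter (· ≤ k)

/-- The part of `S` lying to the right of position `k + 1`, shifted so as to count positions
from there. -/
def above (k : ℕ) (S : Finset ℕ) : Finset ℕ := (S.filter (k + 1 < ·)).image (· - (k + 1))

lemma mem_below {k j : ℕ} {S : Finset ℕ} : j ∈ below k S ↔ j ≤ k ∧ j ∈ S := by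
  simp [below, and_comm]

lemma mem_above {k j : ℕ} {S : Finset ℕ} : j ∈ above k S ↔ 0 < j ∧ j + k + 1 ∈ S := by
  simp only [above, Finset.mem_image, Finset.mem_filter]
  constructor
  · rintro ⟨a, ⟨ha, hk⟩, rfl⟩
    refine ⟨by omega, ?_⟩
    rwa [show a - (k + 1) + k + 1 = a by omega]
  · rintro ⟨h0, h⟩
    exact ⟨_, ⟨h, by omega⟩, by omega⟩

lemma mem_arrangements {U : Finset ℕ} {l : List ℕ} :
    l ∈ arrangements U ↔ l.Nodup ∧ l.toFinset = U := by
  rw [arrangements, Multiset.mem_toFinset, Multiset.mem_lists_iff]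
  constructor
  · intro h
    have hn : l.Nodup := by
      have := U.nodup
      rw [h] at this
      simpa using this
    refine ⟨hn, Finset.val_injective ?_⟩
    rw [h, List.toFinset_val, hn.dedup]
    rfl
  · rintro ⟨hn, rfl⟩
    rw [List.toFinset_val, hn.dedup]
    rfl

lemma length_eq_card {U : Finset ℕ} {l : List ℕ} (h : l ∈ arrangements U) :
    l.length = U.card := by
  obtain ⟨hn, rfl⟩ := mem_arrangements.1 h
  exact (List.toFinset_card_of_nodup hn).symm

lemma mem_listPeaks {l : List ℕ} {j : ℕ} : j ∈ listPeaks l ↔ (1 < j ∧ j < l.length) ∧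
    l.getD (j - 2) 0 < l.getD (j - 1) 0 ∧ l.getD j 0 < l.getD (j - 1) 0 := by
  simp [listPeaks]

lemma getD_lt {l : List ℕ} {M j : ℕ} (h : ∀ x ∈ l, x < M) (hj : j < l.length) :
    l.getD j 0 < M := by
  rw [List.getD_eq_getElem _ _ hj]
  exact h _ (List.getElem_mem hj)

lemma mem_listPeaks_append_cons {l₁ l₂ : List ℕ} {M : ℕ} (h₁ : ∀ x ∈ l₁, x < M)
    (h₂ : ∀ x ∈ l₂, x < M) (j : ℕ) :
    j ∈ listPeaks (l₁ ++ M :: l₂) ↔ j ∈ listPeaks l₁ ∨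
      (j = l₁.length + 1 ∧ 0 < l₁.length ∧ 0 < l₂.length) ∨
      (l₁.length + 1 < j ∧ j - (l₁.length + 1) ∈ listPeaks l₂) := by
  have hL : ∀ n, n < l₁.length → (l₁ ++ M :: l₂).getD n 0 = l₁.getD n 0 :=
    fun n hn => List.getD_append _ _ _ _ hn
  have hM : (l₁ ++ M :: l₂).getD l₁.length 0 = M := by
    rw [List.getD_append_right _ _ _ _ le_rfl]; simp
  have hR : ∀ n, l₁.length < n →
      (l₁ ++ M :: l₂).getD n 0 = l₂.getD (n - (l₁.length + 1)) 0 := by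
    intro n hn
    rw [List.getD_append_right _ _ _ _ hn.le,
      show n - l₁.length = (n - (l₁.length + 1)) + 1 by omega, List.getD_cons_succ]
  simp only [mem_listPeaks, List.length_append, List.length_cons]
  rcases lt_trichotomy j (l₁.length + 1) with hj | rfl | hj
  · rcases Nat.lt_succ_iff_lt_or_eq.1 hj with hj' | rfl
    · by_cases hj1 : 1 < j
      · rw [hL _ hj', hL (j - 1) (by omega), hL (j - 2) (by omega)]
        constructor
        · rintro ⟨-, h⟩
          exact Or.inl ⟨⟨hj1, hj'⟩, h⟩
        · rintro (⟨-, h⟩ | h | h)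
          · exact ⟨by omega, h⟩
          · omega
          · omega
      · omega
    · by_cases h1 : 1 < l₁.length
      · rw [hM, hL (l₁.length - 1) (by omega)]
        have := getD_lt h₁ (show l₁.length - 1 < l₁.length by omega)
        omega
      · omega
  · by_cases h0 : 0 < l₁.length ∧ 0 < l₂.length
    · rw [show l₁.length + 1 - 1 = l₁.length by omega, hM, hL _ (by omega), hR _ (by omega)]
      have a := getD_lt h₁ (show l₁.length + 1 - 2 < l₁.length by omega)
      have b := getD_lt h₂ (show l₁.length + 1 - (l₁.length + 1) < l₂.length by omega)
      omega
    · omega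
  · rw [hR j (by omega), hR (j - 1) (by omega)]
    by_cases h2 : j = l₁.length + 2
    · subst h2
      rw [show l₁.length + 2 - 2 = l₁.length by omega, hM]
      by_cases h0 : 0 < l₂.length
      · have := getD_lt h₂ (show l₁.length + 2 - 1 - (l₁.length + 1) < l₂.length by omega)
        omega
      · omega
    · rw [hR (j - 2) (by omega),
        show j - 1 - (l₁.length + 1) = j - (l₁.length + 1) - 1 by omega,
        show j - 2 - (l₁.length + 1) = j - (l₁.length + 1) - 2 by omega]
      omega

lemma listPeaks_append_cons_eq_iff {l₁ l₂ : List ℕ} {M : ℕ} (h₁ : ∀ x ∈ l₁, x < M)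
    (h₂ : ∀ x ∈ l₂, x < M) (S : Finset ℕ) :
    listPeaks (l₁ ++ M :: l₂) = S ↔
      (l₁.length + 1 ∈ S ↔ 0 < l₁.length ∧ 0 < l₂.length) ∧
        listPeaks l₁ = below l₁.length S ∧ listPeaks l₂ = above l₁.length S := by
  have hb₁ : ∀ j ∈ listPeaks l₁, 1 < j ∧ j < l₁.length := fun j h => (mem_listPeaks.1 h).1
  have hb₂ : ∀ j ∈ listPeaks l₂, 1 < j ∧ j < l₂.length := fun j h => (mem_listPeaks.1 h).1
  constructor
  · rintro rfl
    refine ⟨?_, ?_, ?_⟩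
    · rw [mem_listPeaks_append_cons h₁ h₂]
      have := hb₁ (l₁.length + 1)
      constructor
      · rintro (h | h | h)
        · have := this h
          omega
        · exact h.2
        · omega
      · exact fun h => Or.inr (Or.inl ⟨rfl, h⟩)
    · ext j
      rw [mem_below, mem_listPeaks_append_cons h₁ h₂]
      constructor
      · exact fun h => ⟨(hb₁ j h).2.le, Or.inl h⟩
      · rintro ⟨hj, h | h | h⟩
        · exact h
        · omega
        · omega
    · ext j
      rw [mem_above, mem_listPeaks_append_cons h₁ h₂,
        show j + l₁.length + 1 - (l₁.length + 1) = j by omega]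
      constructor
      · intro h
        have := hb₂ j h
        exact ⟨by omega, Or.inr (Or.inr ⟨by omega, h⟩)⟩
      · rintro ⟨hj, h | h | h⟩
        · have := hb₁ _ h
          omega
        · omega
        · exact h.2
  · rintro ⟨h, e₁, e₂⟩
    ext j
    rw [mem_listPeaks_append_cons h₁ h₂, e₁, e₂, mem_below, mem_above]
    rcases lt_trichotomy j (l₁.length + 1) with hj | rfl | hj
    · constructor
      · rintro (h | h | h)
        · exact h.2
        · omega
        · omega
      · exact fun h => Or.inl ⟨by omega, h⟩
    · rw [h]
      omega
    · rw [show j - (l₁.length + 1) + l₁.length + 1 = j by omega]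
      constructor
      · rintro (h | h | h)
        · exact h.2
        · omega
        · exact h.2.2
      · exact fun h => Or.inr (Or.inr ⟨hj, by omega, h⟩)

/-- Splitting arrangements at the largest element `M`. -/
lemma arrangementCount_insert {U : Finset ℕ} {M : ℕ} (hU : ∀ x ∈ U, x < M) (S : Finset ℕ) :
    arrangementCount S (insert M U) = ∑ V ∈ U.powerset,
      if (V.card + 1 ∈ S ↔ 0 < V.card ∧ V.card < U.card) then
        arrangementCount (below V.card S) V * arrangementCount (above V.card S) (U \ V)
      else 0 := by
  have hMU : M ∉ U := fun h => lt_irrefl _ (hU M h)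
  rw [← Finset.sum_filter]
  simp only [arrangementCount, ← Finset.card_product]
  rw [← Finset.card_sigma]
  symm
  refine Finset.card_bij (fun x _ => x.2.1 ++ M :: x.2.2) ?_ ?_ ?_
  · rintro ⟨V, l₁, l₂⟩ h
    simp only [Finset.mem_sigma, Finset.mem_filter, Finset.mem_powerset, Finset.mem_product] at h ⊢
    obtain ⟨⟨hV, hS⟩, ⟨m₁, e₁⟩, m₂, e₂⟩ := h
    have c₁ := length_eq_card m₁
    have c₂ := length_eq_card m₂
    rw [Finset.card_sdiff_of_subset hV] at c₂
    have hc := Finset.card_le_card hV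
    obtain ⟨n₁, t₁⟩ := mem_arrangements.1 m₁
    obtain ⟨n₂, t₂⟩ := mem_arrangements.1 m₂
    have s₁ : ∀ x, x ∈ l₁ ↔ x ∈ V := by intro x; rw [← t₁, List.mem_toFinset]
    have s₂ : ∀ x, x ∈ l₂ ↔ x ∈ U ∧ x ∉ V := by
      intro x; rw [← Finset.mem_sdiff, ← t₂, List.mem_toFinset]
    constructor
    · rw [mem_arrangements]
      constructor
      · rw [List.nodup_append, List.nodup_cons]
        refine ⟨n₁, ⟨fun h => hMU ((s₂ M).1 h).1, n₂⟩, ?_⟩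
        intro a ha b hb hab
        subst hab
        rw [s₁] at ha
        rcases List.mem_cons.1 hb with rfl | hb
        · exact hMU (hV ha)
        · exact ((s₂ _).1 hb).2 ha
      · ext x
        simp only [List.mem_toFinset, List.mem_append, List.mem_cons, s₁, s₂, Finset.mem_insert]
        have := @hV x
        tauto
    · rw [listPeaks_append_cons_eq_iff (fun x hx => hU x (hV ((s₁ x).1 hx)))
        (fun x hx => hU x ((s₂ x).1 hx).1), c₁, c₂]
      exact ⟨by rw [hS]; omega, e₁, e₂⟩
  · rintro ⟨V, l₁, l₂⟩ h ⟨V', l₁', l₂'⟩ h' heq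
    simp only [Finset.mem_sigma, Finset.mem_filter, Finset.mem_powerset, Finset.mem_product,
      mem_arrangements] at h h' heq
    obtain ⟨⟨hV, -⟩, ⟨⟨-, t₁⟩, -⟩, ⟨-, t₂⟩, -⟩ := h
    obtain ⟨⟨hV', -⟩, ⟨⟨-, t₁'⟩, -⟩, -⟩ := h'
    have k₁ : M ∉ l₁ := fun h => hMU (hV (t₁ ▸ List.mem_toFinset.2 h))
    have k₂ : M ∉ l₂ := fun h => hMU
      (Finset.mem_sdiff.1 (t₂ ▸ List.mem_toFinset.2 h : M ∈ U \ V)).1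
    obtain ⟨rfl, -, rfl⟩ := (List.append_cons_inj_of_notMem k₁ k₂).1 heq
    rw [← t₁, ← t₁']
  · intro l hl
    simp only [Finset.mem_filter] at hl
    obtain ⟨ml, el⟩ := hl
    have cl := length_eq_card ml
    obtain ⟨nl, tl⟩ := mem_arrangements.1 ml
    have hM : M ∈ l := by rw [← List.mem_toFinset, tl]; exact Finset.mem_insert_self _ _
    obtain ⟨l₁, l₂, rfl⟩ := List.append_of_mem hM
    rw [List.nodup_append, List.nodup_cons] at nl
    obtain ⟨n₁, ⟨hM₂, n₂⟩, hd⟩ := nl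
    have hmem : ∀ x, (x ∈ l₁ ∨ x = M ∨ x ∈ l₂) ↔ (x = M ∨ x ∈ U) := by
      intro x
      rw [← Finset.mem_insert, ← tl, List.mem_toFinset, List.mem_append, List.mem_cons]
    have hM₁ : M ∉ l₁ := fun h => hd M h M (by simp) rfl
    have u₁ : ∀ x ∈ l₁, x ∈ U := fun x hx =>
      ((hmem x).1 (Or.inl hx)).resolve_left (fun h => hM₁ (h ▸ hx))
    have u₂ : ∀ x ∈ l₂, x ∈ U := fun x hx =>
      ((hmem x).1 (Or.inr (Or.inr hx))).resolve_left (fun h => hM₂ (h ▸ hx))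
    have hsub : l₁.toFinset ⊆ U := fun x hx => u₁ x (List.mem_toFinset.1 hx)
    have hc : l₁.toFinset.card = l₁.length := List.toFinset_card_of_nodup n₁
    rw [listPeaks_append_cons_eq_iff (fun x hx => hU x (u₁ x hx))
      (fun x hx => hU x (u₂ x hx))] at el
    rw [Finset.card_insert_of_notMem hMU, List.length_append, List.length_cons] at cl
    refine ⟨⟨l₁.toFinset, l₁, l₂⟩, ?_, rfl⟩
    simp only [Finset.mem_sigma, Finset.mem_filter, Finset.mem_powerset, Finset.mem_product,
      mem_arrangements, hc]
    refine ⟨⟨hsub, ?_⟩, ⟨⟨n₁, trivial⟩, el.2.1⟩, ⟨n₂, ?_⟩, el.2.2⟩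
    · rw [el.1]
      omega
    · ext x
      simp only [List.mem_toFinset, Finset.mem_sdiff]
      constructor
      · exact fun hx => ⟨u₂ x hx, fun h => hd x h x (by simp [hx]) rfl⟩
      · rintro ⟨hx, hx₁⟩
        rcases (hmem x).2 (Or.inr hx) with h | h | h
        · exact absurd h hx₁
        · exact absurd (h ▸ hx) hMU
        · exact h

lemma arrangementCount_insert_of_forall {U : Finset ℕ} {M : ℕ} (hU : ∀ x ∈ U, x < M)
    (S : Finset ℕ)
    (h : ∀ S V : Finset ℕ, V.card ≤ U.card → arrangementCount S V = peakCount S V.card) :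
    arrangementCount S (insert M U) = ∑ k ∈ Finset.range (U.card + 1),
      if (k + 1 ∈ S ↔ 0 < k ∧ k < U.card) then
        U.card.choose k * (peakCount (below k S) k * peakCount (above k S) (U.card - k))
      else 0 := by
  rw [arrangementCount_insert hU]
  trans ∑ V ∈ U.powerset, (fun k => if (k + 1 ∈ S ↔ 0 < k ∧ k < U.card) then
      peakCount (below k S) k * peakCount (above k S) (U.card - k) else 0) V.card
  · refine Finset.sum_congr rfl fun V hV => ?_
    have hV := Finset.mem_powerset.1 hV
    rw [h _ V (Finset.card_le_card hV), h _ (U \ V) (Finset.card_le_card Finset.sdiff_subset),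
      Finset.card_sdiff_of_subset hV]
  · rw [Finset.sum_powerset_apply_card (fun k => if (k + 1 ∈ S ↔ 0 < k ∧ k < U.card) then
      peakCount (below k S) k * peakCount (above k S) (U.card - k) else 0)]
    refine Finset.sum_congr rfl fun k _ => ?_
    rw [smul_eq_mul, mul_ite, mul_zero]

/-- The number of arrangements of `U` with a given peak set depends only on the size of `U`. -/
lemma arrangementCount_eq_peakCount (S U : Finset ℕ) :
    arrangementCount S U = peakCount S U.card := by
  induction hn : U.card using Nat.strong_induction_on generalizing S U with
  | _ n ih =>
    rcases n with _ | n
    · rw [Finset.card_eq_zero.1 hn, peakCount, Finset.range_zero]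
    · have h : ∀ S V : Finset ℕ, V.card ≤ n → arrangementCount S V = peakCount S V.card :=
        fun S V hV => ih _ (by omega) S V rfl
      have hne : U.Nonempty := Finset.card_pos.1 (by omega)
      have hc : (U.erase (U.max' hne)).card = n := by
        rw [Finset.card_erase_of_mem (Finset.max'_mem _ _), hn, Nat.add_sub_cancel]
      rw [← Finset.insert_erase (Finset.max'_mem U hne),
        arrangementCount_insert_of_forall (fun x hx => Finset.lt_max'_of_mem_erase_max' _ _ hx) S
          (by rwa [hc]), peakCount, Finset.range_add_one (n := n),
        arrangementCount_insert_of_forall (fun x hx => Finset.mem_range.1 hx) S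
          (by rwa [Finset.card_range]), hc, Finset.card_range]

/-- Splitting at the position `k + 1` of the largest value. -/
lemma peakCount_succ (S : Finset ℕ) (n : ℕ) :
    peakCount S (n + 1) = ∑ k ∈ Finset.range (n + 1),
      if (k + 1 ∈ S ↔ 0 < k ∧ k < n) then
        n.choose k * (peakCount (below k S) k * peakCount (above k S) (n - k))
      else 0 := by
  rw [peakCount, Finset.range_add_one,
    arrangementCount_insert_of_forall (fun x hx => Finset.mem_range.1 hx) S
      (fun S V _ => arrangementCount_eq_peakCount S V), Finset.card_range, Finset.range_add_one]

lemma peakCount_eq_zero {S : Finset ℕ} {n s : ℕ} (hs : s ∈ S) (h : s ≤ 1 ∨ n ≤ s) :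
    peakCount S n = 0 := by
  rw [peakCount, arrangementCount, Finset.card_eq_zero, Finset.filter_eq_empty_iff]
  rintro l hl rfl
  have := (mem_listPeaks.1 hs).1
  rw [length_eq_card hl, Finset.card_range] at this
  omega

lemma peakCount_empty_zero : peakCount ∅ 0 = 1 := by
  rw [peakCount, arrangementCount, Finset.card_eq_one]
  refine ⟨[], ?_⟩
  ext l
  rw [Finset.mem_filter, mem_arrangements, Finset.range_zero, List.toFinset_eq_empty_iff,
    Finset.mem_singleton]
  constructor
  · exact fun h => h.1.2
  · rintro rfl
    simp [listPeaks]

/-- Only the two ends and the peaks can carry the largest value. -/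
lemma peakCount_succ_eq_add (S : Finset ℕ) {n : ℕ} (hn : 0 < n)
    (hS : ∀ s ∈ S, 1 < s ∧ s < n + 1) :
    peakCount S (n + 1) = peakCount (above 0 S) n + peakCount S n +
      ∑ s ∈ S, n.choose (s - 1) *
        (peakCount (below (s - 1) S) (s - 1) * peakCount (above (s - 1) S) (n + 1 - s)) := by
  obtain ⟨m, rfl⟩ := Nat.exists_eq_add_one.2 hn
  have h₁ : 0 + 1 ∉ S := fun h => by have := hS _ h; omega
  have h₂ : m + 1 + 1 ∉ S := fun h => by have := hS _ h; omega
  have b₀ : below 0 S = ∅ := by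
    ext j
    simp only [mem_below, Finset.notMem_empty, iff_false]
    rintro ⟨hj, h⟩
    have := hS _ h
    omega
  have b₁ : below (m + 1) S = S := by
    ext j
    rw [mem_below]
    exact ⟨fun h => h.2, fun h => ⟨by have := hS _ h; omega, h⟩⟩
  have a₁ : above (m + 1) S = ∅ := by
    ext j
    simp only [mem_above, Finset.notMem_empty, iff_false]
    rintro ⟨hj, h⟩
    have := hS _ h
    omega
  rw [peakCount_succ, Finset.sum_range_succ, Finset.sum_range_succ',
    if_pos (iff_of_false h₁ (by omega)), if_pos (iff_of_false h₂ (by omega)), b₀, b₁, a₁,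
    Nat.sub_self, peakCount_empty_zero, Nat.choose_zero_right, Nat.choose_self, Nat.sub_zero]
  have hsum : (∑ k ∈ Finset.range m, if (k + 1 + 1 ∈ S ↔ 0 < k + 1 ∧ k + 1 < m + 1) then
      (m + 1).choose (k + 1) * (peakCount (below (k + 1) S) (k + 1) *
        peakCount (above (k + 1) S) (m + 1 - (k + 1))) else 0) =
      ∑ s ∈ S, (m + 1).choose (s - 1) * (peakCount (below (s - 1) S) (s - 1) *
        peakCount (above (s - 1) S) (m + 1 + 1 - s)) := by
    rw [← Finset.sum_filter]
    refine Finset.sum_nbij' (· + 2) (· - 2) ?_ ?_ ?_ ?_ ?_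
    · intro k hk
      rw [Finset.mem_filter, Finset.mem_range] at hk
      exact hk.2.2 (by omega)
    · intro s hs
      have := hS s hs
      rw [Finset.mem_filter, Finset.mem_range, show s - 2 + 1 + 1 = s by omega]
      exact ⟨by omega, iff_of_true hs (by omega)⟩
    · intro k _
      exact Nat.add_sub_cancel _ _
    · intro s hs
      have := hS s hs
      omega
    · intro k _
      rw [show k + 2 - 1 = k + 1 by omega, show m + 1 + 1 - (k + 2) = m + 1 - (k + 1) by omega]
  rw [hsum]
  ring

lemma permVal_eq_getD {m : ℕ} (σ : Equiv.Perm (Fin m)) {j : ℕ} (hj : 1 ≤ j) (hm : j ≤ m) :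
    permVal σ j = (List.ofFn fun x => (σ x : ℕ)).getD (j - 1) 0 := by
  rw [permVal, dif_pos ⟨hj, hm⟩, List.getD_eq_getElem _ _ (by rw [List.length_ofFn]; omega),
    List.getElem_ofFn]

lemma peakSet_eq_listPeaks {m : ℕ} (σ : Equiv.Perm (Fin m)) :
    peakSet σ = listPeaks (List.ofFn fun x => (σ x : ℕ)) := by
  rw [peakSet, listPeaks, List.length_ofFn]
  refine Finset.filter_congr fun j hj => ?_
  rw [Finset.mem_Ioo] at hj
  rw [permVal_eq_getD σ (j := j - 1) (by omega) (by omega),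
    permVal_eq_getD σ (j := j) (by omega) (by omega),
    permVal_eq_getD σ (j := j + 1) (by omega) (by omega), Nat.sub_sub, Nat.add_sub_cancel]

lemma card_perms_eq_peakCount (S : Finset ℕ) (m : ℕ) :
    (Finset.univ.filter fun σ : Equiv.Perm (Fin m) => peakSet σ = S).card = peakCount S m := by
  rw [peakCount, arrangementCount]
  refine Finset.card_bij (fun σ _ => List.ofFn fun x => (σ x : ℕ)) ?_ ?_ ?_
  · intro σ hσ
    rw [Finset.mem_filter] at hσ ⊢
    refine ⟨mem_arrangements.2 ⟨?_, ?_⟩, by rw [← peakSet_eq_listPeaks, hσ.2]⟩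
    · exact List.nodup_ofFn.2 (Fin.val_injective.comp σ.injective)
    · ext x
      rw [List.mem_toFinset, List.mem_ofFn, Finset.mem_range]
      constructor
      · rintro ⟨y, rfl⟩
        exact (σ y).isLt
      · exact fun hx => ⟨σ.symm ⟨x, hx⟩, by simp⟩
  · intro σ _ τ _ h
    ext x
    exact congrFun (List.ofFn_injective h) x
  · intro l hl
    rw [Finset.mem_filter] at hl
    obtain ⟨hl, hS⟩ := hl
    have hlen := length_eq_card hl
    obtain ⟨hn, ht⟩ := mem_arrangements.1 hl
    rw [Finset.card_range] at hlen
    subst hlen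
    have hlt : ∀ x : Fin l.length, l.get x < l.length := fun x => by
      rw [← Finset.mem_range, ← ht, List.mem_toFinset]
      exact List.get_mem l x
    have hinj : Function.Injective fun x : Fin l.length => (⟨l.get x, hlt x⟩ : Fin l.length) :=
      fun x y h => List.nodup_iff_injective_get.1 hn (Fin.mk.inj_iff.1 h)
    have hl' : (List.ofFn fun x =>
        (Equiv.ofBijective _ (Finite.injective_iff_bijective.1 hinj) x : ℕ)) = l := by
      simp only [Equiv.ofBijective_apply]
      exact List.ofFn_get l
    refine ⟨Equiv.ofBijective _ (Finite.injective_iff_bijective.1 hinj), ?_, hl'⟩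
    rw [Finset.mem_filter, peakSet_eq_listPeaks, hl']
    exact ⟨Finset.mem_univ _, hS⟩

lemma peakCount_empty (n : ℕ) : peakCount ∅ (n + 1) = 2 ^ n := by
  have ha : ∀ k, above k ∅ = ∅ := fun k => by simp [above]
  have hb : ∀ k, below k ∅ = ∅ := fun k => by simp [below]
  induction n with
  | zero => simp [peakCount_succ, ha, hb, peakCount_empty_zero]
  | succ n ih =>
    rw [peakCount_succ_eq_add _ n.succ_pos (by simp), ha, ih, Finset.sum_empty]
    ring

lemma two_mul_peakCount_singleton (a b : ℕ) :
    2 * (peakCount {a + 1} (a + b + 1) : ℤ) = 2 ^ (a + b) * ((a + b).choose a - 1) := by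
  induction hn : a + b generalizing a b with
  | zero =>
    obtain ⟨rfl, rfl⟩ : a = 0 ∧ b = 0 := by omega
    simp [peakCount_eq_zero (S := {1}) (s := 1)]
  | succ n ih =>
    rcases a with _ | a
    · simp [peakCount_eq_zero (S := {1}) (s := 1)]
    rcases b with _ | b
    · rw [peakCount_eq_zero (s := a + 1 + 1) (by simp) (by omega), ← hn]
      simp
    obtain rfl : n = a + 1 + b := by omega
    have h₁ := ih a (b + 1) (by omega)
    have h₂ := ih (a + 1) b rfl
    rw [peakCount_succ_eq_add _ (by omega) (by simp), Finset.sum_singleton,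
      show a + 1 + 1 - 1 = a + 1 by omega,
      show a + 1 + b + 1 + 1 - (a + 1 + 1) = b + 1 by omega,
      show above 0 {a + 1 + 1} = {a + 1} from by
        ext x
        simp only [mem_above, Finset.mem_singleton]
        omega,
      show below (a + 1) {a + 1 + 1} = ∅ from by
        ext x
        simp only [mem_below, Finset.mem_singleton, Finset.notMem_empty, iff_false]
        omega,
      show above (a + 1) {a + 1 + 1} = ∅ from by
        ext x
        simp only [mem_above, Finset.mem_singleton, Finset.notMem_empty, iff_false]
        omega,
      peakCount_empty, peakCount_empty, show a + 1 + b + 1 = (a + 1 + b) + 1 by omega,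
      Nat.choose_succ_succ']
    push_cast
    linear_combination h₁ + h₂

lemma peakCount_two (i : ℕ) : (peakCount {2} (i + 2) : ℤ) = 2 ^ i * i := by
  have h := two_mul_peakCount_singleton 1 i
  rw [Nat.choose_one_right, show 1 + i + 1 = i + 2 by omega] at h
  push_cast at h
  refine mul_left_cancel₀ (two_ne_zero (α := ℤ)) ?_
  linear_combination h

lemma peakCount_penultimate (j : ℕ) : (peakCount {j + 1} (j + 2) : ℤ) = 2 ^ j * j := by
  have h := two_mul_peakCount_singleton j 1
  rw [Nat.choose_succ_self_right, show j + 1 + 1 = j + 2 by omega] at h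
  push_cast at h
  refine mul_left_cancel₀ (two_ne_zero (α := ℤ)) ?_
  linear_combination h

/-- Both families of two-element peak sets below satisfy a recurrence of the same shape, which
comes down to this identity. -/
lemma closed_form_step (i j : ℕ) :
    2 * ((j : ℤ) * (i + j + 2).choose (j + 2) + (j + 1) * (i + j + 2).choose (j + 1) - (i + j + 2))
      = (j * (i + j + 1).choose (j + 2) + (j + 1) * (i + j + 1).choose (j + 1) - (i + j + 1)) +
        j * (i + j + 3).choose (j + 2) + (i + j + 3) * ((i + j + 1).choose j - 1) := by
  have h := Nat.choose_succ_right_eq (i + j + 1) j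
  rw [show i + j + 1 - j = i + 1 by omega] at h
  zify at h
  rw [show i + j + 3 = (i + j + 2) + 1 by omega, Nat.choose_succ_succ' (i + j + 2),
    show i + j + 2 = (i + j + 1) + 1 by omega, Nat.choose_succ_succ' (i + j + 1),
    Nat.choose_succ_succ' (i + j + 1)]
  push_cast
  linear_combination h

lemma peakCount_pair_penultimate (i : ℕ) {j : ℕ} (hj : 1 ≤ j) :
    (peakCount {i + 1, i + j + 2} (i + j + 3) : ℤ) = 2 ^ (i + j) *
      (j * (i + j + 1).choose (j + 2) + (j + 1) * (i + j + 1).choose (j + 1) - (i + j + 1)) := by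
  induction i with
  | zero =>
    rw [peakCount_eq_zero (s := 1) (by simp) (by omega), Nat.zero_add, Nat.choose_self,
      Nat.choose_eq_zero_of_lt (by omega)]
    push_cast
    ring
  | succ i ih =>
    have h := two_mul_peakCount_singleton (i + 1) j
    rw [show i + 1 + 1 = i + 2 by omega, show i + 1 + j + 1 = i + j + 2 by omega,
      show i + 1 + j = i + j + 1 by omega,
      show (i + j + 1).choose (i + 1) = (i + j + 1).choose j from
        Nat.choose_symm_of_eq_add (by omega)] at h
    rw [show i + 1 + 1 = i + 2 by omega, show i + 1 + j + 3 = i + j + 3 + 1 by omega,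
      show i + 1 + j + 2 = i + j + 3 by omega, show i + 1 + j + 1 = i + j + 2 by omega,
      show i + 1 + j = i + j + 1 by omega,
      peakCount_succ_eq_add _ (by omega) (by simp; omega), Finset.sum_pair (by omega),
      show i + 2 - 1 = i + 1 by omega, show i + j + 3 - 1 = i + j + 2 by omega,
      show i + j + 3 + 1 - (i + 2) = j + 2 by omega,
      show i + j + 3 + 1 - (i + j + 3) = 0 + 1 by omega,
      show above 0 {i + 2, i + j + 3} = {i + 1, i + j + 2} from by
        ext x
        simp only [mem_above, Finset.mem_insert, Finset.mem_singleton]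
        omega,
      show below (i + 1) {i + 2, i + j + 3} = ∅ from by
        ext x
        simp only [mem_below, Finset.mem_insert, Finset.mem_singleton, Finset.notMem_empty, iff_false]
        omega,
      show above (i + 1) {i + 2, i + j + 3} = {j + 1} from by
        ext x
        simp only [mem_above, Finset.mem_insert, Finset.mem_singleton]
        omega,
      show below (i + j + 2) {i + 2, i + j + 3} = {i + 2} from by
        ext x
        simp only [mem_below, Finset.mem_insert, Finset.mem_singleton]
        omega,
      show above (i + j + 2) {i + 2, i + j + 3} = ∅ from by
        ext x
        simp only [mem_above, Finset.mem_insert, Finset.mem_singleton, Finset.notMem_empty, iff_false]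
        omega,
      peakCount_empty, peakCount_empty,
      peakCount_eq_zero (S := {i + 2, i + j + 3}) (s := i + j + 3) (by simp) (by omega),
      show (i + j + 3).choose (i + 1) = (i + j + 3).choose (j + 2) from
        Nat.choose_symm_of_eq_add (by omega), Nat.choose_succ_self_right]
    push_cast
    rw [ih, peakCount_penultimate]
    refine mul_left_cancel₀ (two_ne_zero (α := ℤ)) ?_
    linear_combination (i + j + 3 : ℤ) * h - 2 * 2 ^ (i + j) * closed_form_step i j

lemma peakCount_pair_two {i : ℕ} (hi : 1 ≤ i) (j : ℕ) :
    (peakCount {2, i + 3} (i + j + 3) : ℤ) = 2 ^ (i + j) *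
      (i * (i + j + 1).choose (i + 2) + (i + 1) * (i + j + 1).choose (i + 1) - (i + j + 1)) := by
  induction j with
  | zero =>
    rw [peakCount_eq_zero (s := i + 3) (by simp) (by omega), Nat.add_zero, Nat.choose_self,
      Nat.choose_eq_zero_of_lt (by omega)]
    push_cast
    ring
  | succ j ih =>
    have h := two_mul_peakCount_singleton i (j + 1)
    rw [show i + (j + 1) + 1 = i + j + 2 by omega, show i + (j + 1) = i + j + 1 by omega] at h
    have hs := closed_form_step j i
    rw [show j + i + 1 = i + j + 1 by omega, show j + i + 2 = i + j + 2 by omega,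
      show j + i + 3 = i + j + 3 by omega] at hs
    rw [show i + (j + 1) + 3 = i + j + 3 + 1 by omega, show i + (j + 1) + 1 = i + j + 2 by omega,
      show i + (j + 1) = i + j + 1 by omega,
      peakCount_succ_eq_add _ (by omega) (by simp), Finset.sum_pair (by omega),
      show 2 - 1 = 0 + 1 by omega, show i + 3 - 1 = i + 2 by omega,
      show i + j + 3 + 1 - (i + 3) = j + 1 by omega,
      show i + j + 3 + 1 - 2 = i + j + 2 by omega,
      show above 0 {2, i + 3} = {1, i + 2} from by
        ext x
        simp only [mem_above, Finset.mem_insert, Finset.mem_singleton]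
        omega,
      show below (0 + 1) {2, i + 3} = ∅ from by
        ext x
        simp only [mem_below, Finset.mem_insert, Finset.mem_singleton, Finset.notMem_empty, iff_false]
        omega,
      show above (0 + 1) {2, i + 3} = {i + 1} from by
        ext x
        simp only [mem_above, Finset.mem_insert, Finset.mem_singleton]
        omega,
      show below (i + 2) {2, i + 3} = {2} from by
        ext x
        simp only [mem_below, Finset.mem_insert, Finset.mem_singleton]
        omega,
      show above (i + 2) {2, i + 3} = ∅ from by
        ext x
        simp only [mem_above, Finset.mem_insert, Finset.mem_singleton, Finset.notMem_empty, iff_false]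
        omega,
      peakCount_empty, peakCount_empty, peakCount_eq_zero (s := 1) (by simp) (by omega),
      Nat.zero_add, Nat.choose_one_right]
    push_cast
    rw [ih, peakCount_two]
    refine mul_left_cancel₀ (two_ne_zero (α := ℤ)) ?_
    linear_combination (i + j + 3 : ℤ) * h - 2 * 2 ^ (i + j) * hs

end PeakCount

open PeakCount

/-- For all integers `i, j ≥ 1`, the number of permutations of `{1,…,i+j+5}`
whose peak set is exactly `{2, i+3, i+j+4}` equals
`2^(i+j) · [(i+j+4)·(j·C(i+j+1,i-1) + (j+1)·C(i+j+1,i) + (i+1)·C(i+j+1,i+1)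
  + i·C(i+j+1,i+2) − 2(i+j+1)) + i·j·C(i+j+4,i+2)]`. -/
theorem card_perms_with_peak_set_triple (i j : ℕ) (hi : 1 ≤ i) (hj : 1 ≤ j) :
    ((Finset.univ.filter fun σ : Equiv.Perm (Fin (i + j + 5)) =>
        peakSet σ = {2, i + 3, i + j + 4}).card : ℤ)
      = 2 ^ (i + j) *
          (((i : ℤ) + j + 4) *
              ((j : ℤ) * (Nat.choose (i + j + 1) (i - 1) : ℤ)
                + ((j : ℤ) + 1) * (Nat.choose (i + j + 1) i : ℤ)
                + ((i : ℤ) + 1) * (Nat.choose (i + j + 1) (i + 1) : ℤ)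
                + (i : ℤ) * (Nat.choose (i + j + 1) (i + 2) : ℤ)
                - 2 * ((i : ℤ) + j + 1))
            + (i : ℤ) * (j : ℤ) * (Nat.choose (i + j + 4) (i + 2) : ℤ)) := by
  have e₁ : (i + j + 1).choose (i - 1) = (i + j + 1).choose (j + 2) :=
    Nat.choose_symm_of_eq_add (by omega)
  have e₂ : (i + j + 1).choose i = (i + j + 1).choose (j + 1) :=
    Nat.choose_symm_of_eq_add (by omega)
  rw [e₁, e₂, card_perms_eq_peakCount, peakCount_succ_eq_add _ (by omega) (by simp; omega),
    Finset.sum_insert (by simp), Finset.sum_pair (by omega),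
    show 2 - 1 = 0 + 1 by omega, show i + 3 - 1 = i + 2 by omega,
    show i + j + 4 - 1 = i + j + 3 by omega,
    show i + j + 4 + 1 - 2 = i + j + 3 by omega,
    show i + j + 4 + 1 - (i + 3) = j + 2 by omega,
    show i + j + 4 + 1 - (i + j + 4) = 0 + 1 by omega,
    show above 0 {2, i + 3, i + j + 4} = {1, i + 2, i + j + 3} from by
      ext x
      simp only [mem_above, Finset.mem_insert, Finset.mem_singleton]
      omega,
    show below (0 + 1) {2, i + 3, i + j + 4} = ∅ from by
      ext x
      simp only [mem_below, Finset.mem_insert, Finset.mem_singleton, Finset.notMem_empty, iff_false]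
      omega,
    show above (0 + 1) {2, i + 3, i + j + 4} = {i + 1, i + j + 2} from by
      ext x
      simp only [mem_above, Finset.mem_insert, Finset.mem_singleton]
      omega,
    show below (i + 2) {2, i + 3, i + j + 4} = {2} from by
      ext x
      simp only [mem_below, Finset.mem_insert, Finset.mem_singleton]
      omega,
    show above (i + 2) {2, i + 3, i + j + 4} = {j + 1} from by
      ext x
      simp only [mem_above, Finset.mem_insert, Finset.mem_singleton]
      omega,
    show below (i + j + 3) {2, i + 3, i + j + 4} = {2, i + 3} from by
      ext x
      simp only [mem_below, Finset.mem_insert, Finset.mem_singleton]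
      omega,
    show above (i + j + 3) {2, i + 3, i + j + 4} = ∅ from by
      ext x
      simp only [mem_above, Finset.mem_insert, Finset.mem_singleton, Finset.notMem_empty, iff_false]
      omega,
    peakCount_empty, peakCount_eq_zero (S := {1, i + 2, i + j + 3}) (s := 1) (by simp) (by omega),
    peakCount_eq_zero (S := {2, i + 3, i + j + 4}) (s := i + j + 4) (by simp) (by omega),
    Nat.zero_add, Nat.choose_one_right,
    Nat.choose_succ_self_right]
  push_cast
  rw [peakCount_pair_penultimate i hj, peakCount_pair_two hi j, peakCount_two,
    peakCount_penultimate]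
  ring
end

section
/- With p_0 = 1/3 and p_n = n(n+3)·2^{n+1}/(n+4)! for n ≥ 1, one has ∑_{n=0}^∞ p_n = 2/3; equivalently, ∑_{n=1}^∞ n(n+3)·2^{n+1}/(n+4)! = 1/3. -/
/-- Partial sums telescope, since `pₙ` is half the second difference of `2 ^ k / k!`. -/
theorem sum_range_succ_crater_gap (N : ℕ) :
    ∑ n ∈ Finset.range (N + 1),
      (if n = 0 then (1 : ℝ) / 3
        else (n : ℝ) * ((n : ℝ) + 3) * 2 ^ (n + 1) / (Nat.factorial (n + 4) : ℝ)) =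
    2 / 3 + ((2 : ℝ) ^ (N + 4) / (Nat.factorial (N + 4) : ℝ) -
      2 ^ (N + 3) / (Nat.factorial (N + 3) : ℝ)) / 2 := by
  induction N with
  | zero => norm_num [Nat.factorial]
  | succ N ih =>
    rw [Finset.sum_range_succ, ih, if_neg N.succ_ne_zero]
    have h : (Nat.factorial (N + 3) : ℝ) ≠ 0 := by positivity
    have h₄ : (Nat.factorial (N + 4) : ℝ) = (N + 4) * Nat.factorial (N + 3) := by
      rw [Nat.factorial_succ]; push_cast; ring
    have h₅ : (Nat.factorial (N + 1 + 4) : ℝ) = (N + 5) * ((N + 4) * Nat.factorial (N + 3)) := by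
      rw [← h₄, show N + 1 + 4 = (N + 4) + 1 by ring, Nat.factorial_succ]; push_cast; ring
    rw [show N + 1 + 3 = N + 4 by ring, h₅, h₄]
    push_cast
    field_simp
    ring

theorem hasSum_crater_gap :
    HasSum (fun n : ℕ =>
      if n = 0 then (1 : ℝ) / 3
      else (n : ℝ) * ((n : ℝ) + 3) * 2 ^ (n + 1) / (Nat.factorial (n + 4) : ℝ)) (2 / 3) := by
  rw [hasSum_iff_tendsto_nat_of_nonneg (fun n => by split_ifs <;> positivity),
    ← Filter.tendsto_add_atTop_iff_nat 1]
  simp only [sum_range_succ_crater_gap]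
  have h (k : ℕ) := (Filter.tendsto_add_atTop_iff_nat k).2
    (FloorSemiring.tendsto_pow_div_factorial_atTop (2 : ℝ))
  simpa using (((h 4).sub (h 3)).div_const 2).const_add (2 / 3)

/-- With `p₀ = 1/3` and `pₙ = n(n+3)·2^(n+1)/(n+4)!` for `n ≥ 1`,
the series `∑_{n=0}^∞ pₙ` converges and equals `2/3`. -/
theorem sum_crater_gap_probabilities :
    (Summable fun n : ℕ =>
      if n = 0 then (1 : ℝ) / 3
      else (n : ℝ) * ((n : ℝ) + 3) * 2 ^ (n + 1) / (Nat.factorial (n + 4) : ℝ)) ∧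
    (∑' n : ℕ,
      (if n = 0 then (1 : ℝ) / 3
        else (n : ℝ) * ((n : ℝ) + 3) * 2 ^ (n + 1) / (Nat.factorial (n + 4) : ℝ))) = 2 / 3 := by
  exact ⟨hasSum_crater_gap.summable, hasSum_crater_gap.tsum_eq⟩
end

section
/- With p_n = n(n+3)·2^{n+1}/(n+4)! for n ≥ 1, one has ∑_{n=1}^∞ n·p_n = 2/3; that is, ∑_{n=1}^∞ n²(n+3)·2^{n+1}/(n+4)! = 2/3. -/
open Filter Topology in
theorem tendsto_crater_gap_tail :
    Tendsto (fun n : ℕ => (2 * (n : ℝ) ^ 2 + 2 * n + 4) * 2 ^ n / (Nat.factorial (n + 3) : ℝ))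
      atTop (𝓝 0) := by
  refine squeeze_zero (fun n => by positivity) (fun n => ?_)
    (FloorSemiring.tendsto_pow_div_factorial_atTop (2 : ℝ))
  have hn : (0 : ℝ) ≤ n := n.cast_nonneg
  have hf : (0 : ℝ) < Nat.factorial n := by positivity
  rw [div_le_div_iff₀ (by positivity) hf]
  simp only [Nat.factorial_succ]
  push_cast
  have hq : 2 * (n : ℝ) ^ 2 + 2 * n + 4 ≤ (n + 2 + 1) * ((n + 1 + 1) * (n + 1)) := by
    nlinarith [pow_nonneg hn 3, sq_nonneg (n : ℝ)]
  calc (2 * (n : ℝ) ^ 2 + 2 * n + 4) * 2 ^ n * (Nat.factorial n : ℝ)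
      = (2 * (n : ℝ) ^ 2 + 2 * n + 4) * (2 ^ n * (Nat.factorial n : ℝ)) := by ring
    _ ≤ ((n : ℝ) + 2 + 1) * ((n + 1 + 1) * (n + 1)) * (2 ^ n * (Nat.factorial n : ℝ)) := by gcongr
    _ = _ := by ring

theorem sum_range_crater_gap (N : ℕ) :
    ∑ n ∈ Finset.range N,
      (n : ℝ) ^ 2 * ((n : ℝ) + 3) * 2 ^ (n + 1) / (Nat.factorial (n + 4) : ℝ) =
    2 / 3 - (2 * (N : ℝ) ^ 2 + 2 * N + 4) * 2 ^ N / (Nat.factorial (N + 3) : ℝ) := by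
  induction N with
  | zero => norm_num [Nat.factorial]
  | succ N ih =>
    have hf : (Nat.factorial (N + 3) : ℝ) ≠ 0 := by positivity
    have hN : (N : ℝ) + 4 ≠ 0 := by positivity
    have hs : (Nat.factorial (N + 4) : ℝ) = (N + 4) * Nat.factorial (N + 3) := by
      rw [Nat.factorial_succ]
      push_cast
      ring
    rw [Finset.sum_range_succ, ih, show N + 1 + 3 = N + 4 by ring, hs]
    push_cast
    field_simp
    ring

/-- With `pₙ = n(n+3)·2^(n+1)/(n+4)!` for `n ≥ 1`, the series `∑_{n=1}^∞ n·pₙ`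
converges and equals `2/3`; i.e. `∑_{n=1}^∞ n²(n+3)·2^(n+1)/(n+4)! = 2/3`.
(The `n = 0` term of the sum below vanishes, so summing over all `n : ℕ` is the same.) -/
theorem sum_n_crater_gap_probabilities :
    (Summable fun n : ℕ =>
      (n : ℝ) ^ 2 * ((n : ℝ) + 3) * 2 ^ (n + 1) / (Nat.factorial (n + 4) : ℝ)) ∧
    (∑' n : ℕ, (n : ℝ) ^ 2 * ((n : ℝ) + 3) * 2 ^ (n + 1) / (Nat.factorial (n + 4) : ℝ))
      = 2 / 3 := by
  have h : HasSum (fun n : ℕ =>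
      (n : ℝ) ^ 2 * ((n : ℝ) + 3) * 2 ^ (n + 1) / (Nat.factorial (n + 4) : ℝ)) (2 / 3) := by
    rw [hasSum_iff_tendsto_nat_of_nonneg (fun n => by positivity)]
    simp only [sum_range_crater_gap]
    simpa using tendsto_crater_gap_tail.const_sub (2 / 3)
  exact ⟨h.summable, h.tsum_eq⟩
end

section
/- For every real number x, the series ∑_{n=1}^∞ (2n(n+3)/(n+4)!) · x^{n+4} converges and equals (2x³)/3 + 2x² + 2e^x (x−2)² − 8. -/
/-- The exponential series with its first `k` terms removed. -/
theorem hasSum_exp_tail (x : ℝ) (k : ℕ) :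
    HasSum (fun n : ℕ => x ^ (n + k) / (Nat.factorial (n + k) : ℝ))
      (Real.exp x - ∑ i ∈ Finset.range k, x ^ i / (Nat.factorial i : ℝ)) := by
  have h := NormedSpace.expSeries_div_hasSum_exp x
  rw [← Real.exp_eq_exp_ℝ] at h
  exact (hasSum_nat_add_iff' k).mpr h

/-- For every real `x`, the series `∑_{n=1}^∞ (2n(n+3)/(n+4)!)·x^(n+4)` converges
and equals `2x³/3 + 2x² + 2eˣ(x−2)² − 8`.
(The `n = 0` term of the sum below vanishes, so summing over all `n : ℕ` is the same.) -/
theorem power_series_identity_one (x : ℝ) :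
    HasSum
      (fun n : ℕ => 2 * (n : ℝ) * ((n : ℝ) + 3) / (Nat.factorial (n + 4) : ℝ) * x ^ (n + 4))
      (2 * x ^ 3 / 3 + 2 * x ^ 2 + 2 * Real.exp x * (x - 2) ^ 2 - 8) := by
  have h := ((((hasSum_exp_tail x 2).mul_left (x ^ 2)).sub
    ((hasSum_exp_tail x 3).mul_left (4 * x))).add
    ((hasSum_exp_tail x 4).mul_left 4)).mul_left 2
  convert h using 1
  · rfl
  · funext n
    have hfac : (Nat.factorial (n + 2) : ℝ) ≠ 0 := by positivity
    have h3 : (n : ℝ) + 3 ≠ 0 := by positivity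
    have h4 : (n : ℝ) + 4 ≠ 0 := by positivity
    have e3 : (Nat.factorial (n + 3) : ℝ) = (n + 3) * Nat.factorial (n + 2) := by
      rw [Nat.factorial_succ (n + 2)]
      push_cast
      ring
    have e4 : (Nat.factorial (n + 4) : ℝ) = (n + 4) * ((n + 3) * Nat.factorial (n + 2)) := by
      rw [Nat.factorial_succ (n + 3), ← e3]
      push_cast
      ring
    rw [e4, e3]
    field_simp
    ring
  · simp only [Finset.sum_range_succ, Finset.sum_range_zero, Nat.factorial]
    push_cast
    ring
end

section
/- For every real number x, the series ∑_{n=1}^∞ (2n²(n+3)/(n+4)!) · x^{n+4} converges and equals 2e^x (x³ − 6x² + 16x − 16) − (2/3)(x³ + 6x² − 48). -/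
/-- For every real `x`, the series `∑_{n=1}^∞ (2n²(n+3)/(n+4)!)·x^(n+4)` converges
and equals `2eˣ(x³ − 6x² + 16x − 16) − (2/3)(x³ + 6x² − 48)`.
(The `n = 0` term of the sum below vanishes, so summing over all `n : ℕ` is the same.) -/
theorem power_series_identity_two (x : ℝ) :
    HasSum
      (fun n : ℕ => 2 * (n : ℝ) ^ 2 * ((n : ℝ) + 3) / (Nat.factorial (n + 4) : ℝ) * x ^ (n + 4))
      (2 * Real.exp x * (x ^ 3 - 6 * x ^ 2 + 16 * x - 16) - 2 / 3 * (x ^ 3 + 6 * x ^ 2 - 48)) := by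
  have h := ((((hasSum_exp_tail x 1).mul_left (2 * x ^ 3)).sub
    ((hasSum_exp_tail x 2).mul_left (12 * x ^ 2))).add
    ((hasSum_exp_tail x 3).mul_left (32 * x))).sub ((hasSum_exp_tail x 4).mul_left 32)
  convert! h using 1
  · funext n
    have hn : (Nat.factorial n : ℝ) ≠ 0 := by positivity
    simp only [Nat.factorial_succ]
    push_cast
    field_simp
    ring
  · simp only [Finset.sum_range_succ, Finset.sum_range_zero, Nat.factorial]
    push_cast
    ring
end

section
/- For every ε > 0 there exist constants c₁, c₂ > 0 such that for every integer n ≥ 1 the following holds. Among the permutations σ of {1,…,n+4} whose peak set is exactly {2, n+3}, each such σ has a unique valley R = R(σ) (which lies strictly between 2 and n+3), and the number of such permutations with |R/n − 1/2| > ε is at most c₁ e^{−c₂ n} times the total number of permutations of {1,…,n+4} with peak set exactly {2, n+3}. -/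
open scoped Classical

/-- The valley set of a permutation `σ` of `{1,…,m}` (1-based positions). -/
def valleySet {m : ℕ} (σ : Equiv.Perm (Fin m)) : Finset ℕ :=
  (Finset.Ioo 1 m).filter fun j =>
    permVal σ j < permVal σ (j - 1) ∧ permVal σ j < permVal σ (j + 1)

theorem permVal_val_add_one {m : ℕ} (σ : Equiv.Perm (Fin m)) (i : Fin m) :
    permVal σ (i + 1) = σ i := by
  simp [permVal]

theorem permVal_ne_permVal {m : ℕ} (σ : Equiv.Perm (Fin m)) {i j : ℕ} (hi : 1 ≤ i) (him : i ≤ m)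
    (hj : 1 ≤ j) (hjm : j ≤ m) (hij : i ≠ j) : permVal σ i ≠ permVal σ j := by
  intro h
  simp only [permVal, hi, him, hj, hjm, and_self, dite_true] at h
  have := σ.injective (Fin.ext h)
  simp only [Fin.mk.injEq] at this
  omega

/-- A permutation with peak set `{2, n + 3}` first decreases from its first peak down to its
unique valley and then increases up to its second peak. -/
theorem exists_valley {n : ℕ} (σ : Equiv.Perm (Fin (n + 4)))
    (h : peakSet σ = {2, n + 3}) :
    ∃ R : ℕ, valleySet σ = {R} ∧ 2 < R ∧ R < n + 3 ∧
      (∀ i, 2 ≤ i → i < R → permVal σ (i + 1) < permVal σ i) ∧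
      (∀ i, R ≤ i → i < n + 3 → permVal σ i < permVal σ (i + 1)) := by
  have hne : ∀ i, 1 ≤ i → i < n + 4 → permVal σ i ≠ permVal σ (i + 1) := fun i h1 h2 =>
    permVal_ne_permVal σ h1 (by omega) (by omega) (by omega) (by omega)
  have hmem : ∀ j, (1 < j ∧ j < n + 4) ∧
      permVal σ (j - 1) < permVal σ j ∧ permVal σ (j + 1) < permVal σ j ↔
        j = 2 ∨ j = n + 3 := by
    intro j
    have := Finset.ext_iff.1 h j
    simpa [peakSet] using this
  have h2 := ((hmem 2).2 (Or.inl rfl)).2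
  have h3 := ((hmem (n + 3)).2 (Or.inr rfl)).2
  simp only [show n + 3 - 1 = n + 2 by omega] at h2 h3
  have hex : ∃ i, 2 ≤ i ∧ permVal σ i < permVal σ (i + 1) := ⟨n + 2, by omega, h3.1⟩
  obtain ⟨R, ⟨hR2, hR⟩, hmin⟩ : ∃ R, (2 ≤ R ∧ permVal σ R < permVal σ (R + 1)) ∧
      ∀ i < R, ¬ (2 ≤ i ∧ permVal σ i < permVal σ (i + 1)) :=
    ⟨Nat.find hex, Nat.find_spec hex, fun i hi => Nat.find_min hex hi⟩
  have hRn : R < n + 3 := by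
    by_contra hc
    exact hmin (n + 2) (by omega) ⟨by omega, h3.1⟩
  have hR2' : 2 < R := by
    rcases hR2.lt_or_eq with hlt | rfl
    · exact hlt
    · have := h2.2
      omega
  have hdec : ∀ i, 2 ≤ i → i < R → permVal σ (i + 1) < permVal σ i := by
    intro i hi hiR
    have h4 := hmin i hiR
    have h5 := hne i (by omega) (by omega)
    omega
  have hinc : ∀ i, R ≤ i → i < n + 3 → permVal σ i < permVal σ (i + 1) := by
    intro i hi
    induction i, hi using Nat.le_induction with
    | base => exact fun _ => hR
    | succ i hi ih =>
      intro hin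
      have h4 := ih (by omega)
      have h5 := hne (i + 1) (by omega) (by omega)
      have h6 := (hmem (i + 1)).not.2 (by omega)
      simp only [Nat.add_sub_cancel] at h6
      omega
  refine ⟨R, ?_, hR2', hRn, hdec, hinc⟩
  ext j
  simp only [valleySet, Finset.mem_filter, Finset.mem_Ioo, Finset.mem_singleton]
  constructor
  · rintro ⟨⟨hj1, hj2⟩, hj3, hj4⟩
    by_contra hjR
    rcases Nat.lt_or_gt_of_ne hjR with hlt | hgt
    · have := hdec j (by omega) hlt
      omega
    · have := hinc (j - 1) (by omega) (by omega)
      rw [Nat.sub_add_cancel (by omega)] at this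
      omega
  · rintro rfl
    have := hdec (j - 1) (by omega) (by omega)
    rw [Nat.sub_add_cancel (by omega)] at this
    exact ⟨⟨by omega, by omega⟩, this, hR⟩

/-- A sorting key on the values of a permutation: `a` comes first and `b` last, the values in `S`
come in decreasing order and are followed by the remaining values in increasing order. -/
def sortKey {m : ℕ} (a b : Fin m) (S : Finset (Fin m)) (v : Fin m) : ℤ :=
  if v = a then -(m + 1) else if v = b then m + 1 else if v ∈ S then -(v : ℤ) else v

theorem sortKey_injective {m : ℕ} (a b : Fin m) (S : Finset (Fin m)) :
    Function.Injective (sortKey a b S) := by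
  intro v w h
  have hv := v.2
  have hw := w.2
  unfold sortKey at h
  split_ifs at h <;> omega

theorem eq_of_monotone_sortKey {m : ℕ} {a b : Fin m} {S : Finset (Fin m)}
    {σ τ : Equiv.Perm (Fin m)} (hσ : Monotone (sortKey a b S ∘ σ))
    (hτ : Monotone (sortKey a b S ∘ τ)) : σ = τ := by
  have h : sortKey a b S ∘ σ = sortKey a b S ∘ τ := Tuple.unique_monotone hσ hτ
  ext i
  exact congrArg Fin.val (sortKey_injective a b S (congrFun h i))

/-- The set of values that `σ` takes at the (1-based) positions `2, …, R`. -/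
def slopeValues {m : ℕ} (σ : Equiv.Perm (Fin m)) (R : ℕ) : Finset (Fin m) :=
  Finset.univ.filter fun v => 1 ≤ (σ.symm v : ℕ) ∧ (σ.symm v : ℕ) < R

theorem card_slopeValues {m : ℕ} (σ : Equiv.Perm (Fin m)) {R : ℕ} (hRm : R ≤ m) :
    (slopeValues σ R).card = R - 1 := by
  have h : ((slopeValues σ R).map σ.symm.toEmbedding).map Fin.valEmbedding = Finset.Ico 1 R := by
    ext j
    simp only [slopeValues, Finset.mem_map, Finset.mem_filter, Finset.mem_univ, true_and,
      Equiv.coe_toEmbedding, Fin.valEmbedding_apply, Finset.mem_Ico]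
    constructor
    · rintro ⟨_, ⟨v, hv, rfl⟩, rfl⟩
      exact hv
    · intro hj
      exact ⟨⟨j, by omega⟩, ⟨σ ⟨j, by omega⟩, by simpa using hj, by simp⟩, rfl⟩
  have := congrArg Finset.card h
  simpa using this

theorem monotone_sortKey_comp {n : ℕ} (σ : Equiv.Perm (Fin (n + 4))) {R : ℕ}
    (hRn : R < n + 3)
    (hdec : ∀ i, 2 ≤ i → i < R → permVal σ (i + 1) < permVal σ i)
    (hinc : ∀ i, R ≤ i → i < n + 3 → permVal σ i < permVal σ (i + 1)) :
    Monotone (sortKey (σ 0) (σ (Fin.last _)) (slopeValues σ R) ∘ σ) := by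
  rw [Fin.monotone_iff_le_succ]
  intro i
  have hi := i.2
  have h1 := (σ i.castSucc).2
  have h2 := (σ i.succ).2
  have e1 := permVal_val_add_one σ i.castSucc
  have e2 := permVal_val_add_one σ i.succ
  simp only [Fin.val_castSucc, Fin.val_succ] at e1 e2
  have hd := hdec (i + 1)
  have hc := hinc (i + 1)
  simp only [Function.comp, sortKey, slopeValues, Finset.mem_filter, Finset.mem_univ, true_and,
    Equiv.symm_apply_apply, EmbeddingLike.apply_eq_iff_eq, Fin.ext_iff, Fin.val_castSucc,
    Fin.val_succ, Fin.val_zero, Fin.val_last]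
  push_cast
  split_ifs <;> omega

/-- A Chernoff bound for the cardinality of a uniformly random subset. -/
theorem card_filter_abs_le (m : ℕ) (t x : ℝ) (ht : 0 ≤ t) :
    ((Finset.univ.filter fun S : Finset (Fin m) => x ≤ |2 * (S.card : ℝ) - m|).card : ℝ) ≤
      2 * 2 ^ m * Real.exp (m * t ^ 2 / 2 - t * x) := by
  have hsum : ∀ s : ℝ, ∑ S : Finset (Fin m), Real.exp (s * (2 * (S.card : ℝ) - m)) ≤
      2 ^ m * Real.exp (m * s ^ 2 / 2) := by
    intro s
    have h := Fintype.sum_pow_mul_eq_add_pow (Fin m) (Real.exp s) (Real.exp (-s))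
    simp only [Fintype.card_fin] at h
    calc ∑ S : Finset (Fin m), Real.exp (s * (2 * (S.card : ℝ) - m))
        = ∑ S : Finset (Fin m), Real.exp s ^ S.card * Real.exp (-s) ^ (m - S.card) := by
          refine Finset.sum_congr rfl fun S _ => ?_
          have hS : S.card ≤ m := by simpa using Finset.card_le_univ S
          rw [← Real.exp_nat_mul, ← Real.exp_nat_mul, ← Real.exp_add, Nat.cast_sub hS]
          ring_nf
      _ = (2 * Real.cosh s) ^ m := by
          rw [h, Real.cosh_eq]
          ring
      _ ≤ (2 * Real.exp (s ^ 2 / 2)) ^ m := by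
          have := Real.cosh_pos s
          gcongr
          exact Real.cosh_le_exp_half_sq s
      _ = 2 ^ m * Real.exp (m * s ^ 2 / 2) := by
          rw [mul_pow, ← Real.exp_nat_mul]
          ring_nf
  have hmarkov : ((Finset.univ.filter fun S : Finset (Fin m) =>
      x ≤ |2 * (S.card : ℝ) - m|).card : ℝ) * Real.exp (t * x) ≤
      2 * 2 ^ m * Real.exp (m * t ^ 2 / 2) := by
    calc _ = ∑ S ∈ Finset.univ.filter fun S : Finset (Fin m) => x ≤ |2 * (S.card : ℝ) - m|,
          Real.exp (t * x) := by simp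
      _ ≤ ∑ S ∈ Finset.univ.filter fun S : Finset (Fin m) => x ≤ |2 * (S.card : ℝ) - m|,
          (Real.exp (t * (2 * (S.card : ℝ) - m)) + Real.exp (-t * (2 * (S.card : ℝ) - m))) := by
          refine Finset.sum_le_sum fun S hS => ?_
          have hx := (Finset.mem_filter.1 hS).2
          rcases le_abs.1 hx with h | h
          · have := Real.exp_le_exp.2 (mul_le_mul_of_nonneg_left h ht)
            have := Real.exp_pos (-t * (2 * (S.card : ℝ) - m))
            linarith
          · have := Real.exp_le_exp.2 (mul_le_mul_of_nonneg_left h ht)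
            have := Real.exp_pos (t * (2 * (S.card : ℝ) - m))
            rw [neg_mul_comm]
            linarith
      _ ≤ ∑ S : Finset (Fin m),
          (Real.exp (t * (2 * (S.card : ℝ) - m)) + Real.exp (-t * (2 * (S.card : ℝ) - m))) :=
          Finset.sum_le_sum_of_subset_of_nonneg (Finset.subset_univ _)
            fun _ _ _ => by positivity
      _ ≤ 2 * 2 ^ m * Real.exp (m * t ^ 2 / 2) := by
          have h1 := hsum t
          have h2 := hsum (-t)
          rw [neg_sq] at h2
          rw [Finset.sum_add_distrib]
          linarith
  rw [Real.exp_sub, ← mul_div_assoc]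
  exact (le_div_iff₀ (Real.exp_pos _)).2 hmarkov

theorem card_valley_le (n : ℕ) (P : ℕ → Prop) :
    (Finset.univ.filter fun σ : Equiv.Perm (Fin (n + 4)) =>
        peakSet σ = {2, n + 3} ∧ ∃ R ∈ valleySet σ, P R).card ≤
      (n + 4) ^ 2 * (Finset.univ.filter fun S : Finset (Fin (n + 4)) => P (S.card + 1)).card := by
  have hR : ∀ σ : Equiv.Perm (Fin (n + 4)), ∃ R : ℕ, peakSet σ = {2, n + 3} →
      valleySet σ = {R} ∧ 2 < R ∧ R < n + 3 ∧
      (∀ i, 2 ≤ i → i < R → permVal σ (i + 1) < permVal σ i) ∧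
      (∀ i, R ≤ i → i < n + 3 → permVal σ i < permVal σ (i + 1)) := by
    intro σ
    by_cases h : peakSet σ = {2, n + 3}
    · obtain ⟨R, hR⟩ := exists_valley σ h
      exact ⟨R, fun _ => hR⟩
    · exact ⟨0, fun h' => absurd h' h⟩
  choose R hR using hR
  have hcard : (n + 4) ^ 2 *
      (Finset.univ.filter fun S : Finset (Fin (n + 4)) => P (S.card + 1)).card =
      ((Finset.univ : Finset (Fin (n + 4) × Fin (n + 4))) ×ˢ
        Finset.univ.filter fun S : Finset (Fin (n + 4)) => P (S.card + 1)).card := by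
    simp [Finset.card_product, sq]
  rw [hcard]
  refine Finset.card_le_card_of_injOn
    (fun σ => ((σ 0, σ (Fin.last _)), slopeValues σ (R σ))) ?_ ?_
  · intro σ hσ
    simp only [Finset.coe_filter, Finset.mem_univ, true_and, Set.mem_ofPred_eq] at hσ
    obtain ⟨hp, r, hr, hPr⟩ := hσ
    obtain ⟨hv, h2, h3, -⟩ := hR σ hp
    rw [hv, Finset.mem_singleton] at hr
    subst hr
    simp only [Finset.coe_product, Finset.coe_univ, Finset.coe_filter, Finset.mem_univ, true_and,
      Set.mem_prod, Set.mem_univ, Set.mem_ofPred_eq]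
    rwa [card_slopeValues σ (by omega), Nat.sub_add_cancel (by omega)]
  · intro σ hσ τ hτ h
    simp only [Finset.coe_filter, Finset.mem_univ, true_and, Set.mem_ofPred_eq] at hσ hτ
    simp only [Prod.mk.injEq] at h
    obtain ⟨⟨h0, hl⟩, hS⟩ := h
    obtain ⟨-, -, a3, a4, a5⟩ := hR σ hσ.1
    obtain ⟨-, -, b3, b4, b5⟩ := hR τ hτ.1
    have hσm := monotone_sortKey_comp σ a3 a4 a5
    have hτm := monotone_sortKey_comp τ b3 b4 b5
    rw [← h0, ← hl, ← hS] at hτm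
    exact eq_of_monotone_sortKey hσm hτm

theorem peakSet_eq_of_strictMono {n : ℕ} (hn : 1 ≤ n) {a b : Fin (n + 4)}
    (ha : (a : ℕ) = n) (hb : (b : ℕ) = n + 1) {S : Finset (Fin (n + 4))}
    (hS : ∀ v ∈ S, (v : ℕ) < n ∨ (v : ℕ) = n + 3)
    (hS' : ∀ v : Fin (n + 4), (v : ℕ) = n + 3 → v ∈ S)
    {σ : Equiv.Perm (Fin (n + 4))} (h : StrictMono (sortKey a b S ∘ σ)) :
    peakSet σ = {2, n + 3} := by
  have key : ∀ v : Fin (n + 4), ((v : ℕ) = n ∧ sortKey a b S v = -(n + 5)) ∨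
      ((v : ℕ) = n + 1 ∧ sortKey a b S v = n + 5) ∨ ((v : ℕ) = n + 2 ∧ sortKey a b S v = n + 2) ∨
      ((v : ℕ) = n + 3 ∧ sortKey a b S v = -(n + 3)) ∨
      ((v : ℕ) < n ∧ (sortKey a b S v = v ∨ sortKey a b S v = -v)) := by
    intro v
    have hv := v.2
    have h1 := hS v
    have h2 := hS' v
    by_cases hvS : v ∈ S <;>
      simp only [hvS, forall_const, imp_false] at h1 h2 <;>
      simp only [sortKey, Fin.ext_iff, ha, hb, hvS, if_true, if_false] <;>
      push_cast <;> split_ifs <;> omega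
  have hstep : ∀ i j : Fin (n + 4), i < j ↔ sortKey a b S (σ i) < sortKey a b S (σ j) :=
    fun i j => h.lt_iff_lt.symm
  have hpos : ∀ (i : Fin (n + 4)) (c : ℕ) (hc : c < n + 4), (σ i : ℕ) ≠ c →
      ∃ j, j ≠ i ∧ (σ j : ℕ) = c := by
    intro i c hc hi
    refine ⟨σ.symm ⟨c, hc⟩, ?_, by simp⟩
    rintro rfl
    simp at hi
  have hinj : ∀ i j : Fin (n + 4), i ≠ j → (σ i : ℕ) ≠ σ j := fun i j hij he =>
    hij (σ.injective (Fin.ext he))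
  have hfirst : ∀ i : Fin (n + 4), (i : ℕ) = 0 → (σ i : ℕ) = n := by
    intro i hi
    by_contra hc
    obtain ⟨j, hji, hj⟩ := hpos i n (by omega) hc
    have h1 := (hstep i j).1 (by omega)
    have h2 := key (σ i)
    have h3 := key (σ j)
    omega
  have hlast : ∀ i : Fin (n + 4), (i : ℕ) = n + 3 → (σ i : ℕ) = n + 1 := by
    intro i hi
    by_contra hc
    obtain ⟨j, hji, hj⟩ := hpos i (n + 1) (by omega) hc
    have h1 := (hstep j i).1 (by omega)
    have h2 := key (σ i)
    have h3 := key (σ j)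
    omega
  have hsecond : ∀ i : Fin (n + 4), (i : ℕ) = 1 → (σ i : ℕ) = n + 3 := by
    intro i hi
    by_contra hc
    obtain ⟨j, hji, hj⟩ := hpos i (n + 3) (by omega) hc
    have h0 := hfirst ⟨0, by omega⟩ rfl
    have hj0 : (j : ℕ) ≠ 0 := fun hj0 => by
      have := hfirst j hj0
      omega
    have h1 := (hstep i j).1 (by omega)
    have h2 := key (σ i)
    have h3 := key (σ j)
    have h4 := hinj i ⟨0, by omega⟩ (by simp [Fin.ext_iff, hi])
    omega
  have hpenult : ∀ i : Fin (n + 4), (i : ℕ) = n + 2 → (σ i : ℕ) = n + 2 := by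
    intro i hi
    by_contra hc
    obtain ⟨j, hji, hj⟩ := hpos i (n + 2) (by omega) hc
    have h0 := hlast ⟨n + 3, by omega⟩ rfl
    have hj0 : (j : ℕ) ≠ n + 3 := fun hj0 => by
      have := hlast j hj0
      omega
    have h1 := (hstep j i).1 (by omega)
    have h2 := key (σ i)
    have h3 := key (σ j)
    have h4 := hinj i ⟨n + 3, by omega⟩ (by simp [Fin.ext_iff, hi])
    omega
  have hp : ∀ (j : ℕ) (hj : j < n + 4), permVal σ (j + 1) = σ ⟨j, hj⟩ := fun j hj =>
    permVal_val_add_one σ ⟨j, hj⟩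
  have f0 := hfirst ⟨0, by omega⟩ rfl
  have f1 := hsecond ⟨1, by omega⟩ rfl
  have f2 := hpenult ⟨n + 2, by omega⟩ rfl
  have f3 := hlast ⟨n + 3, by omega⟩ rfl
  ext j
  simp only [peakSet, Finset.mem_filter, Finset.mem_Ioo, Finset.mem_insert, Finset.mem_singleton]
  by_cases hj : 1 < j ∧ j < n + 4
  swap
  · omega
  obtain ⟨i, rfl⟩ : ∃ i, j = i + 2 := ⟨j - 2, by omega⟩
  rw [show i + 2 - 1 = i + 1 by omega, hp i (by omega), hp (i + 1) (by omega),
    hp (i + 2) (by omega)]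
  have key0 := key (σ ⟨i, by omega⟩)
  have key1 := key (σ ⟨i + 1, by omega⟩)
  have key2 := key (σ ⟨i + 2, by omega⟩)
  have lt1 := (hstep ⟨i, by omega⟩ ⟨i + 1, by omega⟩).1 (by simp)
  have lt2 := (hstep ⟨i + 1, by omega⟩ ⟨i + 2, by omega⟩).1 (by simp)
  by_cases hi : i = 0
  · have := hsecond ⟨i + 1, by omega⟩ (by simpa using hi)
    have := hfirst ⟨i, by omega⟩ hi
    have := hinj ⟨i + 1, by omega⟩ ⟨i + 2, by omega⟩ (by simp)
    omega
  by_cases hin : i = n + 1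
  · have := hpenult ⟨i + 1, by omega⟩ (by simpa using hin)
    have := hlast ⟨i + 2, by omega⟩ (by simpa using hin)
    have := hinj ⟨i, by omega⟩ ⟨i + 1, by omega⟩ (by simp)
    have := hinj ⟨i, by omega⟩ ⟨1, by omega⟩ (by simp; omega)
    omega
  have g0 := hinj ⟨i + 1, by omega⟩ ⟨0, by omega⟩ (by simp)
  have g1 := hinj ⟨i + 1, by omega⟩ ⟨1, by omega⟩ (by simp; omega)
  have g2 := hinj ⟨i + 1, by omega⟩ ⟨n + 2, by omega⟩ (by simp; omega)
  have g3 := hinj ⟨i + 1, by omega⟩ ⟨n + 3, by omega⟩ (by simp; omega)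
  omega

theorem two_pow_le_card_peakSet {n : ℕ} (hn : 1 ≤ n) :
    2 ^ (n - 1) ≤ (Finset.univ.filter fun σ : Equiv.Perm (Fin (n + 4)) =>
      peakSet σ = {2, n + 3}).card := by
  set a : Fin (n + 4) := ⟨n, by omega⟩ with ha
  set b : Fin (n + 4) := ⟨n + 1, by omega⟩ with hb
  set c : Fin (n + 4) := ⟨n + 3, by omega⟩ with hc
  set z : Fin (n + 4) := ⟨0, by omega⟩ with hz
  have hA : (Finset.Ioo z a).powerset.card = 2 ^ (n - 1) := by
    simp [ha, hz]
  rw [← hA]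
  have hmono : ∀ S : Finset (Fin (n + 4)),
      StrictMono (sortKey a b S ∘ Tuple.sort (sortKey a b S)) := fun S =>
    (Tuple.monotone_sort _).strictMono_of_injective
      ((sortKey_injective a b S).comp (Equiv.injective _))
  have hsub : ∀ T T' : Finset (Fin (n + 4)), T ⊆ Finset.Ioo z a → T' ⊆ Finset.Ioo z a →
      Tuple.sort (sortKey a b (insert c T)) = Tuple.sort (sortKey a b (insert c T')) →
      T ⊆ T' := by
    intro T T' hT hT' he v hv
    by_contra hv'
    have hva := Finset.mem_Ioo.1 (hT hv)
    simp only [Fin.lt_def, hz, ha] at hva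
    have h1 := hmono (insert c T)
    have h2 := hmono (insert c T')
    rw [← he] at h2
    set σ := Tuple.sort (sortKey a b (insert c T))
    clear_value σ
    have h3 := (h1.lt_iff_lt (a := σ.symm v) (b := σ.symm z)).trans
      (h2.lt_iff_lt (a := σ.symm v) (b := σ.symm z)).symm
    simp only [Function.comp, Equiv.apply_symm_apply, sortKey, Finset.mem_insert, hv, hv',
      Fin.ext_iff, ha, hb, hc, hz, or_false, or_true, if_true] at h3
    split_ifs at h3 <;> omega
  refine Finset.card_le_card_of_injOn
    (fun T => Tuple.sort (sortKey a b (insert c T))) ?_ ?_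
  · intro T hT
    rw [Finset.mem_coe, Finset.mem_powerset] at hT
    simp only [Finset.coe_filter, Finset.mem_univ, true_and, Set.mem_ofPred_eq]
    refine peakSet_eq_of_strictMono hn rfl rfl ?_ ?_ (hmono _)
    · intro v hv
      rcases Finset.mem_insert.1 hv with rfl | hv
      · exact Or.inr rfl
      · exact Or.inl (Finset.mem_Ioo.1 (hT hv)).2
    · intro v hv
      exact Finset.mem_insert.2 (Or.inl (Fin.ext hv))
  · intro T hT T' hT' he
    rw [Finset.mem_coe, Finset.mem_powerset] at hT hT'
    exact (hsub T T' hT hT' he).antisymm (hsub T' T hT' hT he.symm)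

/-- For every `ε > 0` there are constants `c₁, c₂ > 0` such that for all `n ≥ 1`:
every permutation of `{1,…,n+4}` with peak set exactly `{2, n+3}` has a unique valley `R`,
which lies strictly between `2` and `n+3`, and the number of such permutations with
`|R/n − 1/2| > ε` is at most `c₁ e^{−c₂ n}` times the total number of permutations of
`{1,…,n+4}` with peak set exactly `{2, n+3}`. -/
theorem mound_concentration (ε : ℝ) (hε : 0 < ε) :
    ∃ c₁ > (0 : ℝ), ∃ c₂ > (0 : ℝ), ∀ n : ℕ, 1 ≤ n →
      (∀ σ : Equiv.Perm (Fin (n + 4)), peakSet σ = {2, n + 3} →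
        ∃ R : ℕ, valleySet σ = {R} ∧ 2 < R ∧ R < n + 3) ∧
      ((Finset.univ.filter fun σ : Equiv.Perm (Fin (n + 4)) =>
          peakSet σ = {2, n + 3} ∧ ∃ R ∈ valleySet σ, |(R : ℝ) / n - 1 / 2| > ε).card : ℝ)
        ≤ c₁ * Real.exp (-c₂ * n) *
          ((Finset.univ.filter fun σ : Equiv.Perm (Fin (n + 4)) =>
            peakSet σ = {2, n + 3}).card : ℝ) := by
  refine ⟨128 / ε ^ 4 * Real.exp (12 * ε ^ 2 + 12 * ε), by positivity, ε ^ 2, by positivity,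
    fun n hn => ⟨fun σ hσ => ?_, ?_⟩⟩
  · obtain ⟨R, h1, h2, h3, -⟩ := exists_valley σ hσ
    exact ⟨R, h1, h2, h3⟩
  have hn0 : (0 : ℝ) < n := by exact_mod_cast hn
  have hbad := card_valley_le n fun R => |(R : ℝ) / n - 1 / 2| > ε
  have hsubset : (Finset.univ.filter fun S : Finset (Fin (n + 4)) =>
      |((S.card + 1 : ℕ) : ℝ) / n - 1 / 2| > ε).card ≤
      (Finset.univ.filter fun S : Finset (Fin (n + 4)) =>
        2 * ε * n - 6 ≤ |2 * (S.card : ℝ) - (n + 4 : ℕ)|).card := by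
    refine Finset.card_le_card (Finset.monotone_filter_right _ fun S _ hS => ?_)
    have h1 : 2 * (S.card : ℝ) - (n + 4 : ℕ) =
        2 * n * (((S.card + 1 : ℕ) : ℝ) / n - 1 / 2) - 6 := by
      push_cast
      field_simp
      ring
    have h2 := abs_sub_abs_le_abs_sub (2 * n * (((S.card + 1 : ℕ) : ℝ) / n - 1 / 2)) 6
    rw [abs_mul, abs_of_pos (show (0 : ℝ) < 2 * n by positivity),
      abs_of_pos (show (0 : ℝ) < 6 by norm_num)] at h2
    rw [h1]
    have h3 := mul_le_mul_of_nonneg_left hS.le (show (0 : ℝ) ≤ 2 * n by positivity)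
    linarith
  have htail := card_filter_abs_le (n + 4) (2 * ε) (2 * ε * n - 6) (by positivity)
  have htotal : (2 : ℝ) ^ (n - 1) ≤ ((Finset.univ.filter fun σ : Equiv.Perm (Fin (n + 4)) =>
      peakSet σ = {2, n + 3}).card : ℝ) := by
    exact_mod_cast two_pow_le_card_peakSet hn
  have hpoly : ((n : ℝ) + 4) ^ 2 ≤ 2 / ε ^ 4 * Real.exp (ε ^ 2 * (n + 4)) := by
    have h := Real.quadratic_le_exp_of_nonneg (show 0 ≤ ε ^ 2 * ((n : ℝ) + 4) by positivity)
    rw [div_mul_eq_mul_div, le_div_iff₀ (by positivity)]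
    have : 0 ≤ ε ^ 2 * ((n : ℝ) + 4) := by positivity
    nlinarith
  have hpow : (2 : ℝ) ^ (n + 4) = 32 * 2 ^ (n - 1) := by
    rw [show n + 4 = 5 + (n - 1) by omega, pow_add]
    norm_num
  calc _ ≤ ((n : ℝ) + 4) ^ 2 * ((Finset.univ.filter fun S : Finset (Fin (n + 4)) =>
        2 * ε * n - 6 ≤ |2 * (S.card : ℝ) - (n + 4 : ℕ)|).card : ℝ) := by
        exact_mod_cast hbad.trans (Nat.mul_le_mul_left _ hsubset)
    _ ≤ (2 / ε ^ 4 * Real.exp (ε ^ 2 * (n + 4))) * (2 * 2 ^ (n + 4) *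
          Real.exp ((n + 4 : ℕ) * (2 * ε) ^ 2 / 2 - 2 * ε * (2 * ε * n - 6))) := by
        gcongr
    _ = 128 / ε ^ 4 * Real.exp (12 * ε ^ 2 + 12 * ε) * Real.exp (-ε ^ 2 * n) * 2 ^ (n - 1) := by
        have : Real.exp (ε ^ 2 * (n + 4)) *
            Real.exp ((n + 4 : ℕ) * (2 * ε) ^ 2 / 2 - 2 * ε * (2 * ε * n - 6)) =
            Real.exp (12 * ε ^ 2 + 12 * ε) * Real.exp (-ε ^ 2 * n) := by
          rw [← Real.exp_add, ← Real.exp_add]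
          push_cast
          ring_nf
        rw [hpow]
        linear_combination 128 / ε ^ 4 * 2 ^ (n - 1) * this
    _ ≤ _ := by gcongr
end

section
/- Let G be a finite connected ρ-regular simple graph with vertex set V, |V| ≥ 2, which is distance-transitive: for any vertices v, w, x, y with dist(v,w) = dist(x,y) there is a graph automorphism of G carrying v to x and w to y. Let Q be an invariant probability measure for the meteor kernel of G on the state space {f : V → ℝ : f ≥ 0, ∑_{v∈V} f(v) = |V|}. Then for every vertex x, Var_Q(f(x)) ≤ (ρ+1) / (ρ − 1 + 2ρ/(|V|−1)). -/
open scoped Classical ENNReal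
open MeasureTheory ProbabilityTheory

/-- The state space of the meteor process: nonnegative mass configurations of total mass `|V|`. -/
def massStates (V : Type*) : Set (V → ℝ) :=
  {f | (∀ v, 0 ≤ f v) ∧ ∑ᶠ v, f v = (Nat.card V : ℝ)}

/-- One step of the (discrete-time) meteor kernel applied to a measure. -/
noncomputable def meteorStep {V : Type*} (G : SimpleGraph V) (μ : Measure (V → ℝ)) :
    Measure (V → ℝ) :=
  (Nat.card V : ℝ≥0∞)⁻¹ • ∑ᶠ x : V, μ.map (meteorMap G x)

/-- A signed invariant vector of total mass zero vanishes, for a finite Markov matrix in which some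
state can be reached from every other one. -/
lemma eq_zero_of_invariant_of_sum_eq_zero {α : Type*} [Fintype α] (T : α → α → ℝ)
    (hT : ∀ a b, 0 ≤ T a b) (hrow : ∀ a, ∑ b, T a b = 1) (o : α)
    (hreach : ∀ a, Relation.ReflTransGen (fun a b => 0 < T a b) a o) (D : α → ℝ)
    (hD : ∀ b, ∑ a, D a * T a b = D b) (hsum : ∑ a, D a = 0) : ∀ a, D a = 0 := by
  have pos_of_pos : ∀ D : α → ℝ, (∀ b, ∑ a, D a * T a b = D b) → ∀ a, 0 < D a → 0 < D o := by
    intro D hD a ha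
    have hle : ∀ b ∈ Finset.univ, max (D b) 0 ≤ ∑ a, max (D a) 0 * T a b := by
      intro b _
      refine max_le ?_ (Finset.sum_nonneg fun a _ => mul_nonneg (le_max_right _ _) (hT a b))
      rw [← hD b]
      exact Finset.sum_le_sum fun a _ => mul_le_mul_of_nonneg_right (le_max_left _ _) (hT a b)
    have heq : ∑ b, max (D b) 0 = ∑ b, ∑ a, max (D a) 0 * T a b := by
      rw [Finset.sum_comm]
      simp [← Finset.mul_sum, hrow]
    have hstat := (Finset.sum_eq_sum_iff_of_le hle).1 heq
    have hstep : ∀ a b, 0 < D a → 0 < T a b → 0 < D b := by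
      intro a b ha hab
      have h : 0 < max (D b) 0 := by
        rw [hstat b (Finset.mem_univ b)]
        refine lt_of_lt_of_le (mul_pos (lt_max_of_lt_left ha) hab)
          (Finset.single_le_sum (f := fun a => max (D a) 0 * T a b)
            (fun a _ => mul_nonneg (le_max_right _ _) (hT a b)) (Finset.mem_univ a))
      simpa using h
    suffices ∀ b, Relation.ReflTransGen (fun a b => 0 < T a b) a b → 0 < D b from this o (hreach a)
    intro b hb
    induction hb with
    | refl => exact ha
    | tail _ hab ih => exact hstep _ _ ih hab
  have hnp : (∀ a, D a ≤ 0) ∨ ∀ a, 0 ≤ D a := by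
    by_contra! h
    obtain ⟨⟨a, ha⟩, b, hb⟩ := h
    have h₁ := pos_of_pos D hD a ha
    have h₂ := pos_of_pos (fun a => -D a) (fun b => by simp [hD]) b (by simpa using hb)
    linarith
  rcases hnp with h | h
  · exact fun a => (Finset.sum_eq_zero_iff_of_nonpos fun a _ => h a).1 hsum a (Finset.mem_univ a)
  · exact fun a => (Finset.sum_eq_zero_iff_of_nonneg fun a _ => h a).1 hsum a (Finset.mem_univ a)

section Meteor

variable {V : Type*} (G : SimpleGraph V)

/-- The proportion of the mass at `u` that `A_x` sends to `y`. -/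
noncomputable def meteorWeight (x u y : V) : ℝ :=
  if u = x then (if G.Adj x y then ((G.neighborSet x).ncard : ℝ)⁻¹ else 0)
  else if u = y then 1 else 0

lemma meteorWeight_nonneg (x u y : V) : 0 ≤ meteorWeight G x u y := by
  unfold meteorWeight
  split_ifs <;> positivity

lemma meteorWeight_self_pos {ρ : ℕ} (hreg : ∀ v : V, (G.neighborSet v).ncard = ρ) (hρ : 0 < ρ)
    {x y : V} (h : G.Adj x y) : 0 < meteorWeight G x x y := by
  simp [meteorWeight, h, hreg, hρ]

variable [Fintype V]

/-- The transition matrix of the motion of two unit masses under the meteor kernel. -/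
noncomputable def pairKernel (p q : V × V) : ℝ :=
  (Fintype.card V : ℝ)⁻¹ * ∑ x, meteorWeight G x p.1 q.1 * meteorWeight G x p.2 q.2

lemma meteorMap_eq_sum (x : V) (f : V → ℝ) (y : V) :
    meteorMap G x f y = ∑ u, f u * meteorWeight G x u y := by
  have h : ∀ u, f u * meteorWeight G x u y =
      (if u = x then (if G.Adj x y then f x / ((G.neighborSet x).ncard : ℝ) else 0) else 0) +
      (if u = y then (if y = x then 0 else f y) else 0) := by
    intro u
    unfold meteorWeight
    by_cases hu : u = x <;> by_cases hy : u = y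
    · subst hu; subst hy; simp
    · subst hu; simp [hy, div_eq_mul_inv]
    · subst hy; simp [hu]
    · simp [hu, hy]
  rw [Finset.sum_congr rfl fun u _ => h u, Finset.sum_add_distrib]
  unfold meteorMap
  by_cases hy : y = x
  · subst hy; simp
  · by_cases ha : G.Adj x y <;> simp [hy, ha, add_comm]

lemma sum_ite_adj {ρ : ℕ} (hreg : ∀ v : V, (G.neighborSet v).ncard = ρ) (x : V) (a : ℝ) :
    ∑ y, (if G.Adj x y then a else 0) = ρ * a := by
  rw [← Finset.sum_filter, Finset.sum_const, nsmul_eq_mul, ← hreg x,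
    Set.ncard_eq_toFinset_card' (G.neighborSet x)]
  congr 3
  ext y
  simp

lemma sum_meteorWeight {ρ : ℕ} (hreg : ∀ v : V, (G.neighborSet v).ncard = ρ) (hρ : 0 < ρ)
    (x u : V) : ∑ y, meteorWeight G x u y = 1 := by
  unfold meteorWeight
  by_cases hu : u = x
  · simp only [hu, if_true, sum_ite_adj G hreg, hreg]
    field_simp
  · simp [hu]

lemma sum_pairKernel {ρ : ℕ} (hreg : ∀ v : V, (G.neighborSet v).ncard = ρ) (hρ : 0 < ρ)
    (p : V × V) : ∑ q, pairKernel G p q = 1 := by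
  unfold pairKernel
  have : Nonempty V := ⟨p.1⟩
  rw [← Finset.mul_sum, Finset.sum_comm]
  simp [Fintype.sum_prod_type, ← Finset.mul_sum, sum_meteorWeight G hreg hρ]

lemma pairKernel_pos (x : V) (p q : V × V) (h₁ : 0 < meteorWeight G x p.1 q.1)
    (h₂ : 0 < meteorWeight G x p.2 q.2) : 0 < pairKernel G p q := by
  have : Nonempty V := ⟨x⟩
  refine mul_pos (by simp [Fintype.card_pos]) (lt_of_lt_of_le (mul_pos h₁ h₂)
    (Finset.single_le_sum
      (f := fun x => meteorWeight G x p.1 q.1 * meteorWeight G x p.2 q.2)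
      (fun x _ => mul_nonneg (meteorWeight_nonneg G _ _ _) (meteorWeight_nonneg G _ _ _))
      (Finset.mem_univ x)))

lemma pairKernel_reaches {ρ : ℕ} (hreg : ∀ v : V, (G.neighborSet v).ncard = ρ) (hρ : 0 < ρ)
    (hconn : G.Connected) (o : V) (p : V × V) :
    Relation.ReflTransGen (fun p q => 0 < pairKernel G p q) p (o, o) := by
  have diag : ∀ u v : V, G.Walk u v →
      Relation.ReflTransGen (fun p q => 0 < pairKernel G p q) (u, u) (v, v) := by
    intro u v w
    induction w with
    | nil => exact .refl
    | cons h _ ih =>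
      exact .head (pairKernel_pos G _ _ _ (meteorWeight_self_pos G hreg hρ h)
        (meteorWeight_self_pos G hreg hρ h)) ih
  have meet : ∀ u v : V, G.Walk u v →
      Relation.ReflTransGen (fun p q => 0 < pairKernel G p q) (u, v) (v, v) := by
    intro u v w
    induction w with
    | nil => exact .refl
    | @cons u w v h _ ih =>
      by_cases huv : u = v
      · subst huv; exact .refl
      · refine .head (pairKernel_pos G u _ _ (meteorWeight_self_pos G hreg hρ h) ?_) ih
        simp [meteorWeight, Ne.symm huv]
  obtain ⟨u, v⟩ := p
  exact (meet u v (hconn.preconnected u v).some).trans (diag v o (hconn.preconnected v o).some)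

lemma pairKernel_map {ρ : ℕ} (hreg : ∀ v : V, (G.neighborSet v).ncard = ρ) (φ : G ≃g G)
    (p q : V × V) : pairKernel G (φ p.1, φ p.2) (φ q.1, φ q.2) = pairKernel G p q := by
  have hw : ∀ x u y, meteorWeight G (φ x) (φ u) (φ y) = meteorWeight G x u y := by
    intro x u y
    simp [meteorWeight, hreg, φ.map_adj_iff]
  unfold pairKernel
  rw [← Equiv.sum_comp φ.toEquiv]
  simp [hw]

lemma invariant_map_eq {ρ : ℕ} (hreg : ∀ v : V, (G.neighborSet v).ncard = ρ) (hρ : 0 < ρ)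
    (hconn : G.Connected) (C : V × V → ℝ) (hC : ∀ q, ∑ p, C p * pairKernel G p q = C q)
    (φ : G ≃g G) (p : V × V) : C (φ p.1, φ p.2) = C p := by
  obtain ⟨o⟩ := hconn.nonempty
  let e : V × V ≃ V × V := φ.toEquiv.prodCongr φ.toEquiv
  have he : ∀ p, e p = (φ p.1, φ p.2) := fun _ => rfl
  have key := eq_zero_of_invariant_of_sum_eq_zero (pairKernel G)
    (fun p q => mul_nonneg (by positivity) (Finset.sum_nonneg fun x _ =>
      mul_nonneg (meteorWeight_nonneg G _ _ _) (meteorWeight_nonneg G _ _ _)))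
    (sum_pairKernel G hreg hρ) (o, o) (pairKernel_reaches G hreg hρ hconn o)
    (fun p => C (e p) - C p) ?_ ?_ p
  · exact sub_eq_zero.1 key
  · intro q
    simp only [sub_mul, Finset.sum_sub_distrib, hC]
    rw [← hC (e q), ← Equiv.sum_comp e fun p => C p * pairKernel G p (e q)]
    simp only [he, pairKernel_map G hreg]
  · rw [Finset.sum_sub_distrib, Equiv.sum_comp e, sub_self]

lemma card_mul_eq_sum_meteorMap [Nonempty V] (C : V × V → ℝ)
    (hC : ∀ q, ∑ p, C p * pairKernel G p q = C q) (y z : V) :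
    (Fintype.card V : ℝ) * C (y, z) =
      ∑ x, meteorMap G x (fun u => meteorMap G x (fun v => C (u, v)) z) y := by
  have hn : (Fintype.card V : ℝ) ≠ 0 := by simp
  rw [← hC (y, z), Finset.mul_sum]
  simp only [meteorMap_eq_sum, pairKernel, Fintype.sum_prod_type]
  simp only [Finset.sum_mul, Finset.mul_sum]
  conv_rhs => rw [Finset.sum_comm]
  refine Finset.sum_congr rfl fun u _ => ?_
  conv_rhs => rw [Finset.sum_comm]
  refine Finset.sum_congr rfl fun v _ => Finset.sum_congr rfl fun x _ => ?_
  field_simp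

lemma diag_eq {ρ : ℕ} (hreg : ∀ v : V, (G.neighborSet v).ncard = ρ) (hρ : 0 < ρ) [Nonempty V]
    (C : V × V → ℝ) (hC : ∀ q, ∑ p, C p * pairKernel G p q = C q) (c₀ c₁ : ℝ)
    (h₀ : ∀ y, C (y, y) = c₀) (h₁ : ∀ y z, G.Adj y z → C (y, z) = c₁) :
    c₀ = 2 * c₁ + c₀ / ρ := by
  obtain ⟨y⟩ := ‹Nonempty V›
  have h := card_mul_eq_sum_meteorMap G C hC y y
  have hx : ∀ x, meteorMap G x (fun u => meteorMap G x (fun v => C (u, v)) y) y =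
      c₀ - (if x = y then c₀ else 0) +
        (if G.Adj y x then 2 * c₁ / ρ + c₀ / ρ / ρ else 0) := by
    intro x
    by_cases hxy : x = y
    · subst hxy; simp [meteorMap]
    · by_cases ha : G.Adj x y
      · simp only [meteorMap, hreg, h₀, h₁ _ _ ha, h₁ _ _ ha.symm, Ne.symm hxy, hxy, ha, ha.symm,
          if_true, if_false]
        ring
      · simp [meteorMap, h₀, Ne.symm hxy, hxy, ha, G.adj_comm y x]
  rw [Finset.sum_congr rfl fun x _ => hx x, Finset.sum_add_distrib, Finset.sum_sub_distrib,
    sum_ite_adj G hreg, h₀] at h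
  simp only [Finset.sum_const, Finset.card_univ, nsmul_eq_mul, Finset.sum_ite_eq',
    Finset.mem_univ, if_true] at h
  have hρ' : (ρ : ℝ) ≠ 0 := by positivity
  have h' : (ρ : ℝ) * (2 * c₁ / ρ + c₀ / ρ / ρ) = 2 * c₁ + c₀ / ρ := by field_simp
  linarith

lemma superharmonic {ρ : ℕ} (hreg : ∀ v : V, (G.neighborSet v).ncard = ρ)
    (hρ : 0 < ρ) (C : V × V → ℝ) (hC : ∀ q, ∑ p, C p * pairKernel G p q = C q)
    (h₀ : ∀ y, 0 ≤ C (y, y)) {y z : V} (hne : y ≠ z) (hna : ¬ G.Adj y z) :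
    ∑ x, (if G.Adj y x then C (x, z) else 0) + ∑ x, (if G.Adj z x then C (y, x) else 0) ≤
      2 * ρ * C (y, z) := by
  have : Nonempty V := ⟨y⟩
  have h := card_mul_eq_sum_meteorMap G C hC y z
  have hρ' : (0 : ℝ) < ρ := by positivity
  have hx : ∀ x ∈ Finset.univ, C (y, z) - (if x = y then C (y, z) else 0) -
      (if x = z then C (y, z) else 0) +
      ((if G.Adj y x then C (x, z) else 0) + (if G.Adj z x then C (y, x) else 0)) / ρ ≤
      meteorMap G x (fun u => meteorMap G x (fun v => C (u, v)) z) y := by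
    intro x _
    have hna' : ¬ G.Adj z y := fun h => hna h.symm
    by_cases hxy : x = y
    · subst hxy; simp [meteorMap, hne, hna']
    by_cases hxz : x = z
    · subst hxz; simp [meteorMap, hne, hna, hxy]
    have hxx : 0 ≤ C (x, x) / ρ / ρ := div_nonneg (div_nonneg (h₀ x) hρ'.le) hρ'.le
    by_cases hay : G.Adj y x <;> by_cases haz : G.Adj z x <;>
      simp only [meteorMap, hreg, hxy, hxz, Ne.symm hxy, Ne.symm hxz, G.adj_comm x, hay, haz,
        if_true, if_false] <;> ring_nf <;> ring_nf at hxx <;> linarith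
  have hs := Finset.sum_le_sum hx
  rw [← h, Finset.sum_add_distrib, Finset.sum_sub_distrib, Finset.sum_sub_distrib,
    ← Finset.sum_div, Finset.sum_add_distrib] at hs
  simp only [Finset.sum_const, Finset.card_univ, nsmul_eq_mul, Finset.sum_ite_eq',
    Finset.mem_univ, if_true] at hs
  have hs' : (∑ x, (if G.Adj y x then C (x, z) else 0) +
      ∑ x, (if G.Adj z x then C (y, x) else 0)) / ρ ≤ 2 * C (y, z) := by linarith
  rw [div_le_iff₀ hρ'] at hs'
  linarith

lemma exists_adj_of_minimal {ρ : ℕ} (hreg : ∀ v : V, (G.neighborSet v).ncard = ρ)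
    (hρ : 0 < ρ) (hconn : G.Connected) (C : V × V → ℝ)
    (hC : ∀ q, ∑ p, C p * pairKernel G p q = C q)
    (h₀ : ∀ y, 0 ≤ C (y, y)) (m : ℝ) (hm : ∀ y z, y ≠ z → m ≤ C (y, z)) (d : ℕ) :
    ∀ y z, G.dist y z = d → y ≠ z → C (y, z) = m → ∃ u v, G.Adj u v ∧ C (u, v) = m := by
  induction d with
  | zero => exact fun y z hd hne => absurd ((hconn.dist_eq_zero_iff).1 hd) hne
  | succ d ih =>
    intro y z hd hne hyz
    by_cases ha : G.Adj y z
    · exact ⟨y, z, ha, hyz⟩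
    obtain ⟨w, hw⟩ := hconn.exists_walk_length_eq_dist y z
    obtain ⟨x, hyx, hxz⟩ : ∃ x, G.Adj y x ∧ G.dist x z = d := by
      cases w with
      | nil => exact absurd rfl hne
      | @cons _ x _ hyx w =>
        refine ⟨x, hyx, le_antisymm ?_ ?_⟩
        · have := G.dist_le w
          rw [SimpleGraph.Walk.length_cons] at hw
          omega
        · have h1 := hconn.dist_triangle (u := y) (v := x) (w := z)
          rw [SimpleGraph.dist_eq_one_iff_adj.2 hyx] at h1
          omega
    have hxne : x ≠ z := by rintro rfl; exact ha hyx
    refine ih x z hxz hxne (le_antisymm ?_ (hm x z hxne))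
    have hs := superharmonic G hreg hρ C hC h₀ hne ha
    have e₁ : ∑ x, (if G.Adj z x then m else 0) ≤
        ∑ x, (if G.Adj z x then C (y, x) else 0) := by
      refine Finset.sum_le_sum fun u _ => ?_
      split_ifs with hu
      · exact hm y u (by rintro rfl; exact ha hu.symm)
      · exact le_rfl
    have e₂ : C (x, z) - m ≤ ∑ u, (if G.Adj y u then C (u, z) - m else 0) := by
      have hsingle := Finset.single_le_sum
        (f := fun u => if G.Adj y u then C (u, z) - m else 0) (fun u _ => ?_) (Finset.mem_univ x)
      · simpa [hyx] using hsingle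
      · split_ifs with hu
        · exact sub_nonneg.2 (hm u z (by rintro rfl; exact ha hu))
        · exact le_rfl
    have e₃ : ∑ u, (if G.Adj y u then C (u, z) - m else 0) =
        ∑ u, (if G.Adj y u then C (u, z) else 0) - ∑ u, (if G.Adj y u then m else 0) := by
      rw [← Finset.sum_sub_distrib]
      exact Finset.sum_congr rfl fun u _ => by split_ifs <;> simp
    rw [sum_ite_adj G hreg] at e₁ e₃
    rw [hyz] at hs
    linarith

lemma measurable_meteorMap (x : V) : Measurable (meteorMap G x) := by
  refine measurable_pi_lambda _ fun y => ?_
  simp only [meteorMap_eq_sum]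
  fun_prop

lemma ae_massStates (Q : Measure (V → ℝ)) [IsProbabilityMeasure Q]
    (hsupp : Q (massStates V) = 1) :
    ∀ᵐ f ∂Q, (∀ v, 0 ≤ f v) ∧ ∑ v, f v = (Fintype.card V : ℝ) := by
  have hmeas : MeasurableSet (massStates V) := by
    simp only [massStates, finsum_eq_sum_of_fintype, Set.ofPred_and, Set.ofPred_forall]
    refine (MeasurableSet.iInter fun v => ?_).inter ?_
    · exact measurableSet_le measurable_const (measurable_pi_apply v)
    · exact measurableSet_eq_fun (by fun_prop) measurable_const
  have h := (prob_compl_eq_zero_iff hmeas).2 hsupp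
  filter_upwards [compl_mem_ae_iff.2 h] with f hf
  simpa [massStates, finsum_eq_sum_of_fintype] using hf

lemma memLp_coord (Q : Measure (V → ℝ)) [IsProbabilityMeasure Q]
    (hsupp : Q (massStates V) = 1) (v : V) : MemLp (fun f : V → ℝ => f v) 2 Q := by
  refine MemLp.of_bound (measurable_pi_apply v).aestronglyMeasurable (Fintype.card V : ℝ) ?_
  filter_upwards [ae_massStates Q hsupp] with f hf
  rw [Real.norm_eq_abs, abs_of_nonneg (hf.1 v), ← hf.2]
  exact Finset.single_le_sum (fun u _ => hf.1 u) (Finset.mem_univ v)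

lemma integrable_coord_mul (Q : Measure (V → ℝ)) [IsProbabilityMeasure Q]
    (hsupp : Q (massStates V) = 1) (u v : V) : Integrable (fun f : V → ℝ => f u * f v) Q :=
  (memLp_coord Q hsupp u).integrable_mul (memLp_coord Q hsupp v)

lemma secondMoment_invariant (Q : Measure (V → ℝ)) [IsProbabilityMeasure Q]
    (hsupp : Q (massStates V) = 1) (hinv : meteorStep G Q = Q) (q : V × V) :
    ∑ p : V × V, (∫ f, f p.1 * f p.2 ∂Q) * pairKernel G p q = ∫ f, f q.1 * f q.2 ∂Q := by
  obtain ⟨y, z⟩ := q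
  have hexp : ∀ x, (fun f : V → ℝ => meteorMap G x f y * meteorMap G x f z) =
      fun f => ∑ p : V × V, (f p.1 * f p.2) * (meteorWeight G x p.1 y * meteorWeight G x p.2 z) := by
    intro x
    ext f
    simp only [meteorMap_eq_sum, Finset.sum_mul_sum, Fintype.sum_prod_type]
    exact Finset.sum_congr rfl fun u _ => Finset.sum_congr rfl fun v _ => by ring
  have hint : ∀ x, Integrable (fun f : V → ℝ => f y * f z) (Q.map (meteorMap G x)) := by
    intro x
    rw [integrable_map_measure (by fun_prop) (measurable_meteorMap G x).aemeasurable]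
    change Integrable (fun f : V → ℝ => meteorMap G x f y * meteorMap G x f z) Q
    rw [hexp]
    exact integrable_finsetSum _ fun p _ => (integrable_coord_mul Q hsupp p.1 p.2).mul_const _
  have hx : ∀ x, ∫ f, f y * f z ∂(Q.map (meteorMap G x)) =
      ∑ p : V × V, (∫ f, f p.1 * f p.2 ∂Q) *
        (meteorWeight G x p.1 y * meteorWeight G x p.2 z) := by
    intro x
    rw [integral_map (measurable_meteorMap G x).aemeasurable (by fun_prop), hexp,
      integral_finsetSum _ fun p _ => (integrable_coord_mul Q hsupp p.1 p.2).mul_const _]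
    simp only [integral_mul_const]
  have hstep : ∫ f, f y * f z ∂Q = ∫ f, f y * f z ∂(meteorStep G Q) := by rw [hinv]
  rw [hstep, meteorStep, finsum_eq_sum_of_fintype, integral_smul_measure,
    integral_finsetSum_measure fun x _ => hint x, Finset.sum_congr rfl fun x _ => hx x,
    Finset.sum_comm]
  simp only [pairKernel, Finset.mul_sum, smul_eq_mul, ENNReal.toReal_inv, ENNReal.toReal_natCast,
    Nat.card_eq_fintype_card]
  exact Finset.sum_congr rfl fun p _ => Finset.sum_congr rfl fun x _ => by ring

lemma sum_secondMoment (Q : Measure (V → ℝ)) [IsProbabilityMeasure Q]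
    (hsupp : Q (massStates V) = 1) (y : V) :
    ∑ z, ∫ f, f y * f z ∂Q = Fintype.card V * ∫ f, f y ∂Q := by
  rw [← integral_finsetSum _ fun z _ => integrable_coord_mul Q hsupp y z, ← integral_const_mul]
  refine integral_congr_ae ?_
  filter_upwards [ae_massStates Q hsupp] with f hf
  rw [← Finset.mul_sum, hf.2, mul_comm]

lemma sum_mean (Q : Measure (V → ℝ)) [IsProbabilityMeasure Q]
    (hsupp : Q (massStates V) = 1) : ∑ y, ∫ f, f y ∂Q = Fintype.card V := by
  rw [← integral_finsetSum _ fun y _ => (memLp_coord Q hsupp y).integrable (by norm_num),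
    integral_congr_ae ((ae_massStates Q hsupp).mono fun f hf => hf.2)]
  simp

end Meteor

/-- Let `G` be a finite connected `ρ`-regular distance-transitive graph with at
least two vertices, and `Q` an invariant probability measure of the meteor kernel of `G` on the
state space of mass configurations.  Then the stationary variance of the mass at any vertex is
at most `(ρ+1)/(ρ − 1 + 2ρ/(|V|−1))`. -/
theorem distance_transitive_variance_bound {V : Type*} [Fintype V] (G : SimpleGraph V)
    (ρ : ℕ) (hconn : G.Connected) (hcard : 2 ≤ Fintype.card V)
    (hreg : ∀ v : V, (G.neighborSet v).ncard = ρ)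
    (htrans : ∀ v w x y : V, G.dist v w = G.dist x y → ∃ φ : G ≃g G, φ v = x ∧ φ w = y)
    (Q : Measure (V → ℝ)) [IsProbabilityMeasure Q]
    (hsupp : Q (massStates V) = 1) (hinv : meteorStep G Q = Q) (x : V) :
    variance (fun f => f x) Q ≤
      ((ρ : ℝ) + 1) / ((ρ : ℝ) - 1 + 2 * (ρ : ℝ) / ((Fintype.card V : ℝ) - 1)) := by
  classical
  have : Nontrivial V := Fintype.one_lt_card_iff_nontrivial.1 hcard
  have : Nonempty V := ⟨x⟩
  obtain ⟨x', hx'⟩ := hconn.preconnected.exists_adj_of_nontrivial x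
  have hρ : 0 < ρ := by
    rw [← hreg x, Set.ncard_pos]
    exact ⟨x', hx'⟩
  set C : V × V → ℝ := fun p => ∫ f, f p.1 * f p.2 ∂Q with hCdef
  have hC : ∀ q, ∑ p, C p * pairKernel G p q = C q := secondMoment_invariant G Q hsupp hinv
  have hdist : ∀ v w y z, G.dist v w = G.dist y z → C (v, w) = C (y, z) := by
    intro v w y z h
    obtain ⟨φ, rfl, rfl⟩ := htrans v w y z h
    exact (invariant_map_eq G hreg hρ hconn C hC φ (v, w)).symm
  have h₀ : ∀ y, C (y, y) = C (x, x) := fun y => hdist _ _ _ _ (by simp)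
  have h₁ : ∀ y z, G.Adj y z → C (y, z) = C (x, x') := fun y z h => hdist _ _ _ _ (by
    rw [SimpleGraph.dist_eq_one_iff_adj.2 h, SimpleGraph.dist_eq_one_iff_adj.2 hx'])
  have h₀' : ∀ y, 0 ≤ C (y, y) := fun y => integral_nonneg fun f => mul_self_nonneg (f y)
  have hdiag := diag_eq G hreg hρ C hC _ _ h₀ h₁
  have hmin : ∀ y z, y ≠ z → C (x, x') ≤ C (y, z) := by
    obtain ⟨p, hp, hpmin⟩ := Finset.exists_min_image
      (Finset.univ.filter fun p : V × V => p.1 ≠ p.2) C ⟨(x, x'), by simpa using hx'.ne⟩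
    have hm : ∀ y z, y ≠ z → C p ≤ C (y, z) := fun y z h => hpmin (y, z) (by simpa using h)
    obtain ⟨u, v, huv, hu⟩ := exists_adj_of_minimal G hreg hρ hconn C hC h₀' (C p) hm _ p.1 p.2 rfl
      (by simpa using hp) rfl
    rw [← h₁ u v huv, hu]
    exact hm
  have hmean : ∀ y, ∫ f, f y ∂Q = ∫ f, f x ∂Q := by
    intro y
    obtain ⟨φ, hφ, -⟩ := htrans x x y y (by simp)
    have hn : (Fintype.card V : ℝ) ≠ 0 := by simp
    refine mul_left_cancel₀ hn ?_
    rw [← sum_secondMoment Q hsupp, ← sum_secondMoment Q hsupp, ← Equiv.sum_comp φ.toEquiv]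
    refine Finset.sum_congr rfl fun z _ => ?_
    rw [← hφ]
    exact invariant_map_eq G hreg hρ hconn C hC φ (x, z)
  have hn : (2 : ℝ) ≤ Fintype.card V := by exact_mod_cast hcard
  have hone : ∫ f, f x ∂Q = 1 := by
    have h := sum_mean Q hsupp
    rw [Finset.sum_congr rfl fun y _ => hmean y] at h
    simp only [Finset.sum_const, Finset.card_univ, nsmul_eq_mul] at h
    exact mul_left_cancel₀ (by positivity) (h.trans (mul_one _).symm)
  have hsum : C (x, x) + ((Fintype.card V : ℝ) - 1) * C (x, x') ≤ Fintype.card V := by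
    have h := sum_secondMoment Q hsupp x
    rw [hone, mul_one, ← Finset.add_sum_erase _ _ (Finset.mem_univ x)] at h
    have h' : ∑ _z ∈ Finset.univ.erase x, C (x, x') ≤ ∑ z ∈ Finset.univ.erase x, C (x, z) :=
      Finset.sum_le_sum fun z hz => hmin x z (Finset.ne_of_mem_erase hz).symm
    rw [Finset.sum_const, Finset.card_erase_of_mem (Finset.mem_univ x), Finset.card_univ,
      nsmul_eq_mul, Nat.cast_pred (by omega)] at h'
    change C (x, x) + ∑ z ∈ Finset.univ.erase x, C (x, z) = _ at h
    linarith
  have hvar : variance (fun f : V → ℝ => f x) Q = C (x, x) - 1 := by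
    rw [variance_eq_sub (memLp_coord Q hsupp x), hone]
    simp [hCdef, pow_two]
  rw [hvar]
  have hρ1 : (1 : ℝ) ≤ ρ := by exact_mod_cast hρ
  have hn1 : (0 : ℝ) < (Fintype.card V : ℝ) - 1 := by linarith
  have hden : (0 : ℝ) < (ρ : ℝ) - 1 + 2 * (ρ : ℝ) / ((Fintype.card V : ℝ) - 1) := by
    have : 0 < 2 * (ρ : ℝ) / ((Fintype.card V : ℝ) - 1) := by positivity
    linarith
  rw [le_div_iff₀ hden]
  have hc₁ : 2 * ρ * C (x, x') = C (x, x) * (ρ - 1) := by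
    field_simp at hdiag
    linarith
  refine le_of_mul_le_mul_right ?_ hn1
  have e : (C (x, x) - 1) * ((ρ : ℝ) - 1 + 2 * (ρ : ℝ) / ((Fintype.card V : ℝ) - 1)) *
      ((Fintype.card V : ℝ) - 1) =
      (C (x, x) - 1) * (((ρ : ℝ) - 1) * ((Fintype.card V : ℝ) - 1) + 2 * ρ) := by
    field_simp
  rw [e]
  have h2 := mul_le_mul_of_nonneg_left hsum (show (0 : ℝ) ≤ 2 * ρ by positivity)
  linear_combination h2 - ((Fintype.card V : ℝ) - 1) * hc₁
end

section
/- For k ≥ 2 let K_k be the complete graph on the vertex set {1,…,k}, and let Q_k be an invariant probability measure for the meteor kernel of K_k on the state space {f : {1,…,k} → ℝ : f ≥ 0, ∑ f = k} (for the complete graph, A_x sets f(x) to 0 and adds f(x)/(k−1) to every other coordinate). Then for a fixed vertex (say vertex 1), the pushforward of Q_k under the evaluation map f ↦ f(1) converges weakly, as k → ∞, to the exponential distribution with mean 1 (density e^{−t} on [0,∞)). -/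
open scoped Classical ENNReal
open MeasureTheory ProbabilityTheory Filter Topology

lemma charFun_expMeasure_one (t : ℝ) :
    charFun (expMeasure 1) t = (1 - t * Complex.I)⁻¹ := by
  have hpdf : expMeasure 1 = (volume.restrict (Set.Ici 0)).withDensity
      (fun x : ℝ => ENNReal.ofReal (Real.exp (-x))) := by
    rw [expMeasure, gammaMeasure, ← withDensity_indicator measurableSet_Ici]
    congr 1
    ext x
    by_cases hx : 0 ≤ x <;> simp [gammaPDF_eq, hx]
  rw [charFun_apply_real, hpdf, integral_withDensity_eq_integral_toReal_smul (by fun_prop)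
    (ae_of_all _ fun _ => ENNReal.ofReal_lt_top), integral_Ici_eq_integral_Ioi]
  have hre : (t * Complex.I - 1).re < 0 := by simp
  have hne : (1 - t * Complex.I : ℂ) ≠ 0 := fun h => by
    have := congrArg Complex.re h
    simp at this
  calc
    _ = ∫ x : ℝ in Set.Ioi 0, Complex.exp ((t * Complex.I - 1) * x) := by
      congr with x
      rw [ENNReal.toReal_ofReal (Real.exp_pos _).le, Complex.real_smul, Complex.ofReal_exp,
        ← Complex.exp_add]
      congr 1
      push_cast
      ring
    _ = (1 - t * Complex.I)⁻¹ := by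
      rw [integral_exp_mul_complex_Ioi hre]
      have hne' : (t * Complex.I - 1 : ℂ) ≠ 0 := fun h => by simp [h] at hre
      field_simp
      simp

lemma norm_exp_mul_I_sub_one_sub_le (u : ℝ) :
    ‖Complex.exp (u * Complex.I) - 1 - u * Complex.I‖ ≤ 3 * u ^ 2 := by
  have hn : ‖(u * Complex.I : ℂ)‖ = |u| := by simp
  rcases le_total |u| 1 with hu | hu
  · have h := Complex.norm_exp_sub_one_sub_id_le (x := u * Complex.I) (by rwa [hn])
    rw [hn, sq_abs] at h
    nlinarith [sq_nonneg u]
  · have h1 := norm_sub_le (Complex.exp (u * Complex.I) - 1) (u * Complex.I)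
    have h2 := norm_sub_le (Complex.exp (u * Complex.I)) 1
    rw [Complex.norm_exp_ofReal_mul_I, norm_one] at h2
    rw [hn] at h1
    nlinarith [sq_abs u]

section CompleteGraph

variable {V : Type*} [Fintype V]

lemma meteorMap_top_apply (x y : V) (f : V → ℝ) :
    meteorMap ⊤ x f y = if y = x then 0 else f y + f x / (Fintype.card V - 1 : ℝ) := by
  have hcard : (((⊤ : SimpleGraph V).neighborSet x).ncard : ℝ) = Fintype.card V - 1 := by
    have : 1 ≤ Fintype.card V := Fintype.card_pos_iff.2 ⟨x⟩
    rw [SimpleGraph.neighborSet_top, Set.ncard_compl, Set.ncard_singleton,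
      Nat.card_eq_fintype_card, Nat.cast_sub this, Nat.cast_one]
  by_cases h : y = x
  · simp [meteorMap, h]
  · simp only [meteorMap, h, if_false, hcard, SimpleGraph.top_adj, ne_eq, Ne.symm h,
      not_false_eq_true, if_true]

lemma continuous_meteorMap_top (x : V) : Continuous (meteorMap (⊤ : SimpleGraph V) x) := by
  refine continuous_pi fun y => ?_
  simp only [meteorMap_top_apply]
  split_ifs <;> fun_prop

lemma mem_massStates_iff {f : V → ℝ} :
    f ∈ massStates V ↔ (∀ v, 0 ≤ f v) ∧ ∑ v, f v = Fintype.card V := by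
  simp [massStates, finsum_eq_sum_of_fintype]

lemma isClosed_massStates : IsClosed (massStates V) := by
  have : massStates V = (⋂ v, {f | 0 ≤ f v}) ∩ {f | ∑ v, f v = (Fintype.card V : ℝ)} := by
    ext f
    simp [mem_massStates_iff]
  rw [this]
  exact (isClosed_iInter fun v => isClosed_le (by fun_prop) (by fun_prop)).inter
    (isClosed_eq (by fun_prop) (by fun_prop))

lemma isCompact_massStates : IsCompact (massStates V) := by
  refine (isCompact_univ_pi fun _ : V => isCompact_Icc
    (a := (0 : ℝ)) (b := Fintype.card V)).of_isClosed_subset isClosed_massStates ?_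
  intro f hf v _
  rw [mem_massStates_iff] at hf
  exact ⟨hf.1 v, hf.2 ▸ Finset.single_le_sum (fun i _ => hf.1 i) (Finset.mem_univ v)⟩

variable {μ : Measure (V → ℝ)} [IsProbabilityMeasure μ]

lemma ae_mem_massStates (hsupp : μ (massStates V) = 1) : ∀ᵐ f ∂μ, f ∈ massStates V :=
  (prob_compl_eq_zero_iff isClosed_massStates.measurableSet).2 hsupp

lemma integrable_of_continuous_of_massStates (hsupp : μ (massStates V) = 1)
    {E : Type*} [NormedAddCommGroup E] {g : (V → ℝ) → E} (hg : Continuous g) :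
    Integrable g μ := by
  have h := hg.continuousOn.integrableOn_compact (μ := μ) (isCompact_massStates (V := V))
  rwa [IntegrableOn, Measure.restrict_eq_self_of_ae_mem (ae_mem_massStates hsupp)] at h

/-- The integrated generator of the meteor process vanishes at an invariant measure. -/
lemma integral_sum_meteorMap_sub (hsupp : μ (massStates V) = 1)
    (hinv : meteorStep (⊤ : SimpleGraph V) μ = μ)
    {E : Type*} [NormedAddCommGroup E] [NormedSpace ℝ E] [CompleteSpace E]
    {g : (V → ℝ) → E} (hg : Continuous g) :
    ∫ f, ((∑ x, g (meteorMap ⊤ x f)) - (Fintype.card V : ℝ) • g f) ∂μ = 0 := by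
  have hgx (x : V) : Continuous fun f => g (meteorMap ⊤ x f) :=
    hg.comp (continuous_meteorMap_top x)
  have hint (x : V) : Integrable (fun f => g (meteorMap ⊤ x f)) μ :=
    integrable_of_continuous_of_massStates hsupp (hgx x)
  have hmap (x : V) : Integrable g (μ.map (meteorMap ⊤ x)) :=
    (integrable_map_measure hg.aestronglyMeasurable
      (continuous_meteorMap_top x).aemeasurable).2 (hint x)
  have hV : (Fintype.card V : ℝ) ≠ 0 := by
    intro h0
    have : IsEmpty V := Fintype.card_eq_zero_iff.1 (by exact_mod_cast h0)
    have hz : μ = 0 := by rw [← hinv]; simp [meteorStep, finsum_eq_sum_of_fintype]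
    exact IsProbabilityMeasure.ne_zero μ hz
  have key : ∫ f, g f ∂μ = (Fintype.card V : ℝ)⁻¹ • ∑ x, ∫ f, g (meteorMap ⊤ x f) ∂μ := by
    conv_lhs => rw [← hinv]
    rw [meteorStep, finsum_eq_sum_of_fintype, integral_smul_measure,
      integral_finsetSum_measure fun x _ => hmap x]
    simp only [Nat.card_eq_fintype_card, ENNReal.toReal_inv, ENNReal.toReal_natCast]
    congr 2 with x
    exact integral_map (continuous_meteorMap_top x).aemeasurable hg.aestronglyMeasurable
  have hsmul : Integrable (fun f => (Fintype.card V : ℝ) • g f) μ :=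
    (integrable_of_continuous_of_massStates hsupp hg).smul (Fintype.card V : ℝ)
  rw [integral_sub (integrable_finsetSum _ fun x _ => hint x) hsmul, integral_finsetSum _
    fun x _ => hint x, integral_smul, key, smul_inv_smul₀ hV, sub_self]

lemma integral_mass_eq_one (hV : 2 ≤ Fintype.card V) (hsupp : μ (massStates V) = 1)
    (hinv : meteorStep (⊤ : SimpleGraph V) μ = μ) (v : V) : ∫ f, f v ∂μ = 1 := by
  have hN : (2 : ℝ) ≤ Fintype.card V := by exact_mod_cast hV
  have hN1 : (Fintype.card V - 1 : ℝ) ≠ 0 := by linarith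
  have h := integral_sum_meteorMap_sub hsupp hinv (g := fun f => f v) (by fun_prop)
  have hae : (fun f : V → ℝ => (∑ x, meteorMap ⊤ x f v) - (Fintype.card V : ℝ) • f v)
      =ᵐ[μ] fun f => (Fintype.card V / (Fintype.card V - 1 : ℝ)) * (1 - f v) := by
    filter_upwards [ae_mem_massStates hsupp] with f hf
    have hs := (mem_massStates_iff.1 hf).2
    rw [← Finset.add_sum_erase _ _ (Finset.mem_univ v)] at hs ⊢
    have : ∑ x ∈ Finset.univ.erase v, meteorMap ⊤ x f v
        = (Fintype.card V - 1) * f v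
          + (∑ x ∈ Finset.univ.erase v, f x) / (Fintype.card V - 1) := by
      rw [Finset.sum_congr rfl fun x hx => by
        rw [meteorMap_top_apply, if_neg (Finset.ne_of_mem_erase hx).symm]]
      rw [Finset.sum_add_distrib, Finset.sum_const, Finset.card_erase_of_mem (Finset.mem_univ v),
        Finset.sum_div, nsmul_eq_mul, Finset.card_univ, Nat.cast_sub (by omega), Nat.cast_one]
    rw [this, meteorMap_top_apply, if_pos rfl, smul_eq_mul, eq_sub_of_add_eq' hs]
    field_simp
    ring
  rw [integral_congr_ae hae, integral_const_mul, integral_sub (integrable_const _)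
    (integrable_of_continuous_of_massStates hsupp (by fun_prop))] at h
  simp only [integral_const, probReal_univ, smul_eq_mul, mul_one, mul_eq_zero, div_eq_zero_iff,
    hN1, or_false] at h
  rcases h with h | h <;> linarith

lemma integral_sum_sq_mass (hV : 2 ≤ Fintype.card V) (hsupp : μ (massStates V) = 1)
    (hinv : meteorStep (⊤ : SimpleGraph V) μ = μ) :
    ∫ f, ∑ v, f v ^ 2 ∂μ = 2 * Fintype.card V := by
  have hN : (2 : ℝ) ≤ Fintype.card V := by exact_mod_cast hV
  have hN1 : (Fintype.card V - 1 : ℝ) ≠ 0 := by linarith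
  have hN0 : (Fintype.card V : ℝ) ≠ 0 := by linarith
  have h := integral_sum_meteorMap_sub hsupp hinv (g := fun f => ∑ v, f v ^ 2) (by fun_prop)
  have hae : (fun f : V → ℝ => (∑ x, ∑ v, meteorMap ⊤ x f v ^ 2)
        - (Fintype.card V : ℝ) • ∑ v, f v ^ 2)
      =ᵐ[μ] fun f => (Fintype.card V / (Fintype.card V - 1 : ℝ)) *
        (2 * Fintype.card V - ∑ v, f v ^ 2) := by
    filter_upwards [ae_mem_massStates hsupp] with f hf
    have hs := (mem_massStates_iff.1 hf).2
    have hx (x : V) : ∑ v, meteorMap ⊤ x f v ^ 2 = ∑ v, f v ^ 2 - f x ^ 2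
        + 2 * f x / (Fintype.card V - 1) * (Fintype.card V - f x)
        + f x ^ 2 / (Fintype.card V - 1) := by
      have h1 : ∑ v ∈ Finset.univ.erase x, f v = Fintype.card V - f x := by
        rw [← hs, Finset.sum_erase_eq_sub (Finset.mem_univ x)]
      have h2 : ∑ v ∈ Finset.univ.erase x, f v ^ 2 = ∑ v, f v ^ 2 - f x ^ 2 :=
        Finset.sum_erase_eq_sub (Finset.mem_univ x)
      rw [← Finset.add_sum_erase _ (fun v => meteorMap ⊤ x f v ^ 2) (Finset.mem_univ x),
        Finset.sum_congr rfl fun v hv => by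
        rw [meteorMap_top_apply, if_neg (Finset.ne_of_mem_erase hv), add_sq]]
      simp only [Finset.sum_add_distrib, Finset.sum_const, nsmul_eq_mul,
        Finset.card_erase_of_mem (Finset.mem_univ x), ← Finset.sum_mul, ← Finset.mul_sum, h1, h2,
        meteorMap_top_apply, if_true, Finset.card_univ]
      rw [Nat.cast_sub (by omega), Nat.cast_one]
      field_simp
      ring
    simp only [hx, smul_eq_mul]
    have h3 : ∑ x, 2 * f x / (Fintype.card V - 1 : ℝ) * (Fintype.card V - f x)
        = 2 / (Fintype.card V - 1 : ℝ) * (Fintype.card V * ∑ x, f x - ∑ x, f x ^ 2) := by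
      rw [Finset.mul_sum, ← Finset.sum_sub_distrib, Finset.mul_sum]
      exact Finset.sum_congr rfl fun x _ => by ring
    rw [Finset.sum_add_distrib, Finset.sum_add_distrib, Finset.sum_sub_distrib, h3,
      ← Finset.sum_div, hs]
    simp only [Finset.sum_const, nsmul_eq_mul, Finset.card_univ]
    field_simp
    ring
  rw [integral_congr_ae hae, integral_const_mul, integral_sub (integrable_const _)
    (integrable_of_continuous_of_massStates hsupp (by fun_prop))] at h
  simp only [integral_const, probReal_univ, smul_eq_mul, one_mul, mul_eq_zero, div_eq_zero_iff,
    hN1, hN0, or_false, false_or] at h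
  linarith

/-- The defect in the characteristic function equation `1 - ψ + i t ψ = 0` of the exponential
distribution, pointwise on the state space. -/
lemma norm_sum_exp_meteorMap_sub_le (hV : 2 ≤ Fintype.card V) (t : ℝ) (v : V) {f : V → ℝ}
    (hf : f ∈ massStates V) :
    ‖(1 - Complex.exp (t * f v * Complex.I) + t * Complex.I * Complex.exp (t * f v * Complex.I))
      - ((∑ x, Complex.exp (t * meteorMap ⊤ x f v * Complex.I))
        - (Fintype.card V : ℝ) • Complex.exp (t * f v * Complex.I))‖ ≤
      3 * (t / (Fintype.card V - 1)) ^ 2 * ∑ x, f x ^ 2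
        + |t| / (Fintype.card V - 1) * (1 + f v) := by
  obtain ⟨hpos, hs⟩ := mem_massStates_iff.1 hf
  have hN : (2 : ℝ) ≤ Fintype.card V := by exact_mod_cast hV
  have hN1 : (0 : ℝ) < Fintype.card V - 1 := by linarith
  have hN1' : (Fintype.card V - 1 : ℂ) ≠ 0 := by exact_mod_cast hN1.ne'
  set s : ℝ := t / (Fintype.card V - 1) with hsdef
  set e := Complex.exp (t * f v * Complex.I) with he
  have henorm : ‖e‖ = 1 := by
    rw [he, ← Complex.ofReal_mul, Complex.norm_exp_ofReal_mul_I]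
  set R : V → ℂ := fun x => Complex.exp ((s * f x : ℝ) * Complex.I) - 1
    - (s * f x : ℝ) * Complex.I with hR
  have hx (x : V) (hxv : x ∈ Finset.univ.erase v) :
      Complex.exp (t * meteorMap ⊤ x f v * Complex.I)
        = e * R x + e + e * (s * Complex.I) * f x := by
    rw [meteorMap_top_apply, if_neg (Finset.ne_of_mem_erase hxv).symm]
    have : (t * ((f v + f x / (Fintype.card V - 1) : ℝ) : ℂ) * Complex.I)
        = t * f v * Complex.I + (s * f x : ℝ) * Complex.I := by
      rw [hsdef]; push_cast; ring
    rw [this, Complex.exp_add, hR]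
    push_cast
    ring
  have h1 : ∑ x ∈ Finset.univ.erase v, (f x : ℂ) = Fintype.card V - f v := by
    rw [Finset.sum_erase_eq_sub (Finset.mem_univ v)]
    congr 1
    exact_mod_cast hs
  have hid : (1 - e + t * Complex.I * e)
      - ((∑ x, Complex.exp (t * meteorMap ⊤ x f v * Complex.I))
        - (Fintype.card V : ℝ) • e)
      = -(e * ∑ x ∈ Finset.univ.erase v, R x) + e * Complex.I * ((s * (f v - 1) : ℝ) : ℂ) := by
    rw [← Finset.add_sum_erase _ _ (Finset.mem_univ v), Finset.sum_congr rfl hx,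
      Finset.sum_add_distrib, Finset.sum_add_distrib, ← Finset.mul_sum, ← Finset.mul_sum, h1,
      meteorMap_top_apply, if_pos rfl, Finset.sum_const,
      Finset.card_erase_of_mem (Finset.mem_univ v), Finset.card_univ, nsmul_eq_mul,
      Nat.cast_sub (by omega), hsdef]
    simp only [Complex.real_smul]
    push_cast
    simp only [mul_zero, zero_mul, Complex.exp_zero]
    field_simp
    ring
  rw [hid]
  have hRsum : ‖∑ x ∈ Finset.univ.erase v, R x‖ ≤ 3 * s ^ 2 * ∑ x, f x ^ 2 :=
    calc
      _ ≤ ∑ x ∈ Finset.univ.erase v, 3 * (s * f x) ^ 2 :=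
        norm_sum_le_of_le _ fun x _ => norm_exp_mul_I_sub_one_sub_le (s * f x)
      _ ≤ ∑ x, 3 * (s * f x) ^ 2 :=
        Finset.sum_le_sum_of_subset_of_nonneg (Finset.erase_subset _ _)
          fun _ _ _ => by positivity
      _ = 3 * s ^ 2 * ∑ x, f x ^ 2 := by
        rw [Finset.mul_sum]
        exact Finset.sum_congr rfl fun x _ => by ring
  have habs : |s| = |t| / (Fintype.card V - 1) := by rw [hsdef, abs_div, abs_of_pos hN1]
  refine (norm_add_le _ _).trans (add_le_add ?_ ?_)
  · rwa [norm_neg, norm_mul, henorm, one_mul]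
  · rw [norm_mul, norm_mul, henorm, Complex.norm_I, one_mul, one_mul, Complex.norm_real,
      Real.norm_eq_abs, abs_mul, habs]
    gcongr
    rw [abs_le]
    constructor <;> linarith [hpos v]

lemma norm_charFun_equation_le (hV : 2 ≤ Fintype.card V) (hsupp : μ (massStates V) = 1)
    (hinv : meteorStep (⊤ : SimpleGraph V) μ = μ) (v : V) (t : ℝ) :
    ‖1 - (1 - t * Complex.I) * charFun (μ.map fun f => f v) t‖ ≤
      6 * (t / (Fintype.card V - 1)) ^ 2 * Fintype.card V
        + 2 * |t| / (Fintype.card V - 1) := by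
  set g : (V → ℝ) → ℂ := fun f => Complex.exp (t * f v * Complex.I) with hg
  have hgc : Continuous g := by fun_prop
  have hgi := integrable_of_continuous_of_massStates hsupp hgc
  have hchar : charFun (μ.map fun f => f v) t = ∫ f, g f ∂μ := by
    rw [charFun_apply_real, integral_map (measurable_pi_apply v).aemeasurable (by fun_prop)]
  have hDc : Continuous fun f => (∑ x, g (meteorMap ⊤ x f)) - (Fintype.card V : ℝ) • g f :=
    (continuous_finsetSum _ fun x _ => hgc.comp (continuous_meteorMap_top x)).sub
      (hgc.fun_const_smul _)
  have hLc : Continuous fun f => 1 - g f + t * Complex.I * g f := by fun_prop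
  have hL : ∫ f, (1 - g f + t * Complex.I * g f) ∂μ
      = 1 - (1 - t * Complex.I) * charFun (μ.map fun f => f v) t := by
    have hsub : Integrable (fun f => 1 - g f) μ := (integrable_const 1).sub hgi
    rw [integral_add hsub (hgi.const_mul _),
      integral_sub (integrable_const _) hgi, integral_const_mul, hchar]
    simp
    ring
  have hD := integral_sum_meteorMap_sub hsupp hinv hgc
  rw [← hL, ← sub_zero (∫ f, (1 - g f + t * Complex.I * g f) ∂μ), ← hD, ← integral_sub
    (integrable_of_continuous_of_massStates hsupp hLc)
    (integrable_of_continuous_of_massStates hsupp hDc)]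
  have hv : Integrable (fun f : V → ℝ => f v) μ :=
    integrable_of_continuous_of_massStates hsupp (by fun_prop)
  have hsq : Integrable (fun f : V → ℝ => ∑ x, f x ^ 2) μ :=
    integrable_of_continuous_of_massStates hsupp (by fun_prop)
  have hadd : Integrable (fun f : V → ℝ => 1 + f v) μ := (integrable_const 1).add hv
  refine (norm_integral_le_of_norm_le (g := fun f : V → ℝ =>
      3 * (t / (Fintype.card V - 1)) ^ 2 * ∑ x, f x ^ 2
        + |t| / (Fintype.card V - 1) * (1 + f v))
    (integrable_of_continuous_of_massStates hsupp (by fun_prop)) ?_).trans_eq ?_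
  · filter_upwards [ae_mem_massStates hsupp] with f hf
    exact norm_sum_exp_meteorMap_sub_le hV t v hf
  · rw [integral_add (hsq.const_mul _) (hadd.const_mul _),
      integral_const_mul, integral_const_mul, integral_add (integrable_const _) hv,
      integral_sum_sq_mass hV hsupp hinv, integral_mass_eq_one hV hsupp hinv v]
    simp
    ring

end CompleteGraph

lemma tendsto_charFun_of_norm_le {ψ : ℕ → ℂ} {t : ℝ}
    (h : ∀ n : ℕ, ‖1 - (1 - t * Complex.I) * ψ n‖ ≤
      6 * (t / ((n : ℝ) + 1)) ^ 2 * (n + 2) + 2 * |t| / (n + 1)) :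
    Tendsto ψ atTop (𝓝 (1 - t * Complex.I)⁻¹) := by
  have hne : (1 - t * Complex.I : ℂ) ≠ 0 := fun h => by
    have := congrArg Complex.re h
    simp at this
  have h0 : Tendsto (fun n : ℕ => 1 / ((n : ℝ) + 1)) atTop (𝓝 0) :=
    tendsto_one_div_add_atTop_nhds_zero_nat
  have hb : Tendsto (fun n : ℕ => 6 * (t / ((n : ℝ) + 1)) ^ 2 * (n + 2) + 2 * |t| / (n + 1))
      atTop (𝓝 0) := by
    have h1 : Tendsto (fun n : ℕ => 6 * t ^ 2 * ((1 / ((n : ℝ) + 1)) + (1 / ((n : ℝ) + 1)) ^ 2)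
        + 2 * |t| * (1 / ((n : ℝ) + 1))) atTop
        (𝓝 (6 * t ^ 2 * (0 + 0 ^ 2) + 2 * |t| * 0)) :=
      ((h0.add (h0.pow 2)).const_mul _).add (h0.const_mul _)
    simp only [ne_eq, OfNat.ofNat_ne_zero, not_false_eq_true, zero_pow, add_zero, mul_zero] at h1
    refine h1.congr fun n => ?_
    have : (n : ℝ) + 1 ≠ 0 := by positivity
    field_simp
    ring
  have hz := squeeze_zero_norm h hb
  have := (tendsto_const_nhds (x := (1 : ℂ))).sub hz |>.const_mul (1 - t * Complex.I : ℂ)⁻¹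
  rw [sub_zero, mul_one] at this
  refine this.congr fun n => ?_
  field_simp
  ring

/-- For `k ≥ 2` let `Q_k` be an invariant probability measure of the meteor kernel
of the complete graph on `k` vertices.  Then the law of the mass at a fixed vertex under `Q_k`
converges weakly, as `k → ∞`, to the exponential distribution with mean `1`. -/
theorem complete_graph_mass_converges_to_exponential
    (Q : ∀ k : ℕ, Measure (Fin k → ℝ))
    (hprob : ∀ k, 2 ≤ k → IsProbabilityMeasure (Q k))
    (hsupp : ∀ k, 2 ≤ k → Q k (massStates (Fin k)) = 1)
    (hinv : ∀ k, 2 ≤ k → meteorStep (⊤ : SimpleGraph (Fin k)) (Q k) = Q k) :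
    ∀ φ : BoundedContinuousFunction ℝ ℝ,
      Tendsto (fun k : ℕ => ∫ f, φ (f 0) ∂(Q (k + 1))) atTop
        (𝓝 (∫ t, φ t ∂(expMeasure 1))) := by
  intro φ
  rw [← tendsto_add_atTop_iff_nat 1]
  have hP (n : ℕ) : IsProbabilityMeasure (Q (n + 1 + 1)) := hprob _ (by omega)
  let ν : ℕ → ProbabilityMeasure ℝ := fun n =>
    ⟨(Q (n + 1 + 1)).map fun f => f 0, Measure.isProbabilityMeasure_map (measurable_pi_apply 0).aemeasurable⟩
  let ν₀ : ProbabilityMeasure ℝ := ⟨expMeasure 1, isProbabilityMeasure_expMeasure one_pos⟩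
  have hν : Tendsto ν atTop (𝓝 ν₀) := by
    refine ProbabilityMeasure.tendsto_iff_tendsto_charFun.2 fun t => ?_
    change Tendsto (fun n => charFun ((Q (n + 1 + 1)).map fun f => f 0) t) atTop
      (𝓝 (charFun (expMeasure 1) t))
    rw [charFun_expMeasure_one]
    refine tendsto_charFun_of_norm_le fun n => ?_
    have h := norm_charFun_equation_le (μ := Q (n + 1 + 1)) (by simp)
      (hsupp _ (by omega)) (hinv _ (by omega)) 0 t
    have h1 : ((Fintype.card (Fin (n + 1 + 1)) : ℝ) - 1) = n + 1 := by simp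
    have h2 : (Fintype.card (Fin (n + 1 + 1)) : ℝ) = n + 2 := by
      rw [Fintype.card_fin]; push_cast; ring
    rwa [h1, h2] at h
  refine (ProbabilityMeasure.tendsto_iff_forall_integral_tendsto.1 hν φ).congr fun n => ?_
  exact integral_map (measurable_pi_apply 0).aemeasurable φ.continuous.aestronglyMeasurable
end
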